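/- arXiv:2104.10146 — 2 statements merged into one kernel-verified Lean document; each statement's English description precedes it below -/
import Mathlib

section
/- Let K be a subfield of ℂ, R = K[x₁,…,xₙ], M ⊆ R^k a submodule, and P₁,…,P_s the associated primes of the R-module R^k/M. Then there exist finite sets 𝒜₁,…,𝒜_s ⊆ K[x₁,…,xₙ,z₁,…,zₙ]^k such that M = { m ∈ R^k : B•m ∈ P_i for all B ∈ 𝒜_i and all i = 1,…,s }, where for B with coordinates B_j = ∑_α c_{j,α}(x)·z^α the action is B•m := ∑_{j=1}^k ∑_α c_{j,α}·(∂^α m_j) ∈ R. Moreover the sets can be chosen so that the cardinality of 𝒜_i equals the arithmetic length of M along P_i. -/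
set_option synthInstance.maxHeartbeats 1000000
set_option maxHeartbeats 1000000

open MvPolynomial

/-- Iterated formal partial derivative `∂^α q` of a polynomial `q`. -/
noncomputable def ipdP {K : Type*} [CommSemiring K] {n : ℕ} (α : Fin n → ℕ)
    (q : MvPolynomial (Fin n) K) : MvPolynomial (Fin n) K :=
  ((List.ofFn fun i : Fin n => (fun g => (MvPolynomial.pderiv i) g)^[α i]).foldr (· ∘ ·) id) q

/-- The action of the operator associated to a vector `B ∈ K[x][z]^k`
(with `B_j = ∑_α c_{j,α}(x) z^α`) on `m ∈ R^k`: `B•m = ∑_j ∑_α c_{j,α} ∂^α m_j ∈ R`. -/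
noncomputable def NoethAct {K : Type*} [CommSemiring K] {n k : ℕ}
    (B : Fin k → MvPolynomial (Fin n) (MvPolynomial (Fin n) K))
    (m : Fin k → MvPolynomial (Fin n) K) : MvPolynomial (Fin n) K :=
  ∑ j, ∑ α ∈ (B j).support, (B j).coeff α * ipdP (fun i => α i) (m j)

/-- The arithmetic length of the `R`-module `N` along a prime `P`: the length (computed as
the Krull dimension of the lattice of submodules) of the largest finite-length submodule
of the localization `N_P`, i.e. of the submodule of elements annihilated by some power of
`P·R_P`. -/
noncomputable def arithLength (R : Type*) [CommRing R] (N : Type*) [AddCommGroup N]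
    [Module R N] (P : Ideal R) (hP : P.IsPrime) : WithBot ℕ∞ :=
  letI := hP
  Order.krullDim (Submodule (Localization P.primeCompl)
    ↥(⨆ r : ℕ, Submodule.torsionBySet (Localization P.primeCompl)
        (LocalizedModule P.primeCompl N)
        (((P.map (algebraMap R (Localization P.primeCompl))) ^ r :
          Ideal (Localization P.primeCompl)) : Set (Localization P.primeCompl))))

namespace MvPolynomial

section Taylor

variable {σ A : Type*} [CommSemiring A]

/-- The composite of the iterated partial derivatives `∂_i ^ α_i`, for `i` in the list `l`. -/
noncomputable def pderivList (α : σ → ℕ) (l : List σ) : MvPolynomial σ A → MvPolynomial σ A :=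
  (l.map fun i => (fun g => (pderiv i) g)^[α i]).foldr (· ∘ ·) id

theorem pderivList_cons (α : σ → ℕ) (i : σ) (l : List σ) (p : MvPolynomial σ A) :
    pderivList α (i :: l) p = (fun g => (pderiv i) g)^[α i] (pderivList α l p) := rfl

theorem exists_coeff_iterate_pderiv (i : σ) (a : ℕ) (m : σ →₀ ℕ) :
    ∃ u : ℕ, u ≠ 0 ∧ ∀ p : MvPolynomial σ A,
      coeff m ((fun g => (pderiv i) g)^[a] p) = coeff (m + Finsupp.single i a) p * u := by
  induction a with
  | zero => exact ⟨1, one_ne_zero, fun p => by simp⟩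
  | succ a ih =>
    obtain ⟨u, hu, h⟩ := ih
    refine ⟨((m + Finsupp.single i a) i + 1) * u, by positivity, fun p => ?_⟩
    rw [Function.iterate_succ_apply, h, coeff_pderiv, add_assoc, ← Finsupp.single_add]
    push_cast
    ring

theorem exists_coeff_pderivList (α : σ → ℕ) (l : List σ) (m : σ →₀ ℕ) :
    ∃ u : ℕ, u ≠ 0 ∧ ∀ p : MvPolynomial σ A,
      coeff m (pderivList α l p) =
        coeff (m + (l.map fun i => Finsupp.single i (α i)).sum) p * u := by
  induction l generalizing m with
  | nil => exact ⟨1, one_ne_zero, fun p => by simp [pderivList]⟩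
  | cons i l ih =>
    obtain ⟨u, hu, hu'⟩ := exists_coeff_iterate_pderiv (A := A) i (α i) m
    obtain ⟨v, hv, hv'⟩ := ih (m + Finsupp.single i (α i))
    refine ⟨v * u, mul_ne_zero hv hu, fun p => ?_⟩
    rw [pderivList_cons, hu', hv']
    simp [add_assoc, mul_assoc]

theorem ipdP_eq_pderivList {n : ℕ} (α : Fin n → ℕ) (p : MvPolynomial (Fin n) A) :
    ipdP α p = pderivList α (List.finRange n) p := by
  rw [ipdP, pderivList, List.ofFn_eq_map]

theorem exists_constantCoeff_ipdP {n : ℕ} (α : Fin n →₀ ℕ) :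
    ∃ u : ℕ, u ≠ 0 ∧ ∀ p : MvPolynomial (Fin n) A,
      constantCoeff (ipdP α p) = coeff α p * u := by
  obtain ⟨u, hu, h⟩ := exists_coeff_pderivList (A := A) α (List.finRange n) 0
  refine ⟨u, hu, fun p => ?_⟩
  rw [ipdP_eq_pderivList, constantCoeff_eq, h, ← List.ofFn_eq_map, List.sum_ofFn,
    Finsupp.univ_sum_single, zero_add]

variable {B : Type*} [CommSemiring B] [Algebra A B]

/-- The Taylor expansion `f ↦ f(ξ + X)`. -/
noncomputable def taylorHom (ξ : σ → B) : MvPolynomial σ A →ₐ[A] MvPolynomial σ B :=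
  aeval fun i => X i + C (ξ i)

theorem pderiv_taylorHom (ξ : σ → B) (i : σ) (p : MvPolynomial σ A) :
    pderiv i (taylorHom ξ p) = taylorHom ξ (pderiv i p) := by
  classical
  induction p using MvPolynomial.induction_on with
  | C a => simp [taylorHom, algebraMap_apply]
  | add p q hp hq => simp [hp, hq]
  | mul_X p j hp =>
    have hX : pderiv i (taylorHom ξ (X j : MvPolynomial σ A)) =
        taylorHom ξ (pderiv i (X j : MvPolynomial σ A)) := by
      rcases eq_or_ne j i with rfl | h
      · simp [taylorHom]
      · simp [taylorHom, pderiv_X_of_ne h]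
    simp only [map_mul, pderiv_mul, hp, hX, map_add]

theorem pderivList_taylorHom (ξ : σ → B) (α : σ → ℕ) (l : List σ) (p : MvPolynomial σ A) :
    pderivList α l (taylorHom ξ p) = taylorHom ξ (pderivList α l p) := by
  induction l with
  | nil => rfl
  | cons i l ih =>
    rw [pderivList_cons, pderivList_cons, ih]
    exact ((Function.Semiconj.iterate_right (fun q => (pderiv_taylorHom ξ i q).symm) (α i))
      (pderivList α l p)).symm

theorem constantCoeff_taylorHom (ξ : σ → B) (p : MvPolynomial σ A) :
    constantCoeff (taylorHom ξ p) = aeval ξ p := by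
  induction p using MvPolynomial.induction_on with
  | C a => simp [taylorHom, algebraMap_apply]
  | add p q hp hq => simp [hp, hq]
  | mul_X p j hp =>
    rw [map_mul, map_mul, hp, map_mul]
    simp [taylorHom]

theorem exists_aeval_ipdP {n : ℕ} (ξ : Fin n → B) (α : Fin n →₀ ℕ) :
    ∃ u : ℕ, u ≠ 0 ∧ ∀ p : MvPolynomial (Fin n) A,
      aeval ξ (ipdP α p) = coeff α (taylorHom ξ p) * u := by
  obtain ⟨u, hu, h⟩ := exists_constantCoeff_ipdP (A := B) α
  refine ⟨u, hu, fun p => ?_⟩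
  rw [← h, ipdP_eq_pderivList, ipdP_eq_pderivList, pderivList_taylorHom, constantCoeff_taylorHom]

end Taylor

section Extension

variable {σ K F : Type*} [Field K] [Field F] [Algebra K F]

/-- Every `K`-linear functional on `K[x]` with values in `F` extends `F`-linearly along
the Taylor expansion `K[x] → F[x]`. -/
theorem exists_linearMap_taylorHom (ξ : σ → F) (ψ : MvPolynomial σ K →ₗ[K] F) :
    ∃ Ψ : MvPolynomial σ F →ₗ[F] F, ∀ p, Ψ (taylorHom ξ p) = ψ p := by
  let L : MvPolynomial σ F →ₗ[F] F :=
    (basisMonomials σ F).constr F fun α => ψ (monomial α 1)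
  have hL : (L.restrictScalars K) ∘ₗ (mapAlgHom (Algebra.ofId K F)).toLinearMap = ψ := by
    refine (basisMonomials σ K).ext fun α => ?_
    have := (basisMonomials σ F).constr_basis F (fun α => ψ (monomial α 1)) α
    simpa [L] using this
  let τ : MvPolynomial σ F →ₐ[F] MvPolynomial σ F := taylorHom fun i => -ξ i
  have hτ : (τ.restrictScalars K).comp (taylorHom ξ) = mapAlgHom (Algebra.ofId K F) := by
    ext i : 1
    simp [τ, taylorHom]
  refine ⟨L ∘ₗ τ.toLinearMap, fun p => ?_⟩
  rw [← hL, ← hτ]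
  rfl

theorem exists_linearMap_pi_taylorHom {ι : Type*} [Fintype ι] (ξ : σ → F)
    (ψ : (ι → MvPolynomial σ K) →ₗ[K] F) :
    ∃ Ψ : (ι → MvPolynomial σ F) →ₗ[F] F, ∀ q, Ψ (fun j => taylorHom ξ (q j)) = ψ q := by
  classical
  choose Ψ hΨ using fun j => exists_linearMap_taylorHom ξ
    (ψ ∘ₗ LinearMap.single K (fun _ : ι => MvPolynomial σ K) j)
  refine ⟨LinearMap.lsum F _ F Ψ, fun q => ?_⟩
  conv_rhs => rw [← LinearMap.sum_single_apply _ q, map_sum]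
  simp [hΨ]

/-- A linear functional on `F[x]^ι` which agrees with a given functional on a submodule `N`
and has finite order, provided the given functional vanishes on `(x) N`. -/
theorem exists_dual_vanishing_pow {ι : Type*} [Finite ι] [Finite σ]
    (I : Ideal (MvPolynomial σ F))
    (N : Submodule (MvPolynomial σ F) (ι → MvPolynomial σ F))
    (Ψ : (ι → MvPolynomial σ F) →ₗ[F] F) (hΨ : ∀ w ∈ I • N, Ψ w = 0) :
    ∃ (r : ℕ) (Φ : (ι → MvPolynomial σ F) →ₗ[F] F),
      (∀ w ∈ N, Φ w = Ψ w) ∧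
      ∀ w ∈ (I ^ r • ⊤ : Submodule (MvPolynomial σ F) (ι → MvPolynomial σ F)), Φ w = 0 := by
  obtain ⟨r, hr⟩ := I.exists_pow_inf_eq_pow_smul N
  have hle : (I ^ (r + 1) • ⊤ ⊓ N : Submodule _ _) ≤ I • N := by
    rw [hr (r + 1) (by omega), Nat.add_sub_cancel_left, pow_one]
    exact Submodule.smul_mono le_rfl inf_le_right
  let J : Submodule F (ι → MvPolynomial σ F) := (I ^ (r + 1) • ⊤ : Submodule
    (MvPolynomial σ F) (ι → MvPolynomial σ F)).restrictScalars F
  let g : N.restrictScalars F →ₗ[F] (ι → MvPolynomial σ F) ⧸ J :=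
    J.mkQ ∘ₗ (N.restrictScalars F).subtype
  have hmem : Ψ ∘ₗ (N.restrictScalars F).subtype ∈ LinearMap.range g.dualMap := by
    rw [LinearMap.range_dualMap_eq_dualAnnihilator_ker, Submodule.mem_dualAnnihilator]
    rintro ⟨w, hw⟩ hwg
    have : w ∈ J := by simpa [g] using hwg
    exact hΨ w (hle ⟨this, hw⟩)
  obtain ⟨Φ, hΦ⟩ := hmem
  refine ⟨r + 1, Φ ∘ₗ J.mkQ, fun w hw => LinearMap.congr_fun hΦ ⟨w, hw⟩, fun w hw => ?_⟩
  have : J.mkQ w = 0 := by simpa using (show w ∈ J from hw)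
  simp [this]

end Extension

section Operators

variable {n k : ℕ} {K F : Type*} [Field K] [Field F] [Algebra K F]

theorem taylorHom_smul_vanishing (ξ : Fin n → F)
    (Q : Submodule (MvPolynomial (Fin n) K) (Fin k → MvPolynomial (Fin n) K))
    (Ψ : (Fin k → MvPolynomial (Fin n) F) →ₗ[F] F)
    (hΨ : ∀ q ∈ Q, ∀ i, Ψ (fun j => taylorHom ξ (((X i : MvPolynomial (Fin n) K) • q) j)) =
      ξ i * Ψ (fun j => taylorHom ξ (q j))) :
    ∀ w ∈ idealOfVars (Fin n) F • Submodule.span (MvPolynomial (Fin n) F)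
      ((fun (q : Fin k → MvPolynomial (Fin n) K) j => taylorHom ξ (q j)) '' Q), Ψ w = 0 := by
  have hgen : ∀ p : MvPolynomial (Fin n) F, ∀ q ∈ Q,
      Ψ (p • fun j => taylorHom ξ (q j)) = constantCoeff p * Ψ (fun j => taylorHom ξ (q j)) := by
    intro p
    induction p using MvPolynomial.induction_on with
    | C a =>
      intro q _
      rw [constantCoeff_C, ← smul_eq_mul, ← map_smul]
      congr 1
      ext1 j
      simp [smul_eq_C_mul]
    | add p p' hp hp' =>
      intro q hq
      rw [add_smul, map_add, hp q hq, hp' q hq, map_add, add_mul]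
    | mul_X p i hp =>
      intro q hq
      have hX : (X i : MvPolynomial (Fin n) F) • (fun j => taylorHom ξ (q j)) =
          (fun j => taylorHom ξ (((X i : MvPolynomial (Fin n) K) • q) j)) -
            ξ i • (fun j => taylorHom ξ (q j)) := by
        ext1 j
        simp [taylorHom, smul_eq_C_mul, add_mul]
      rw [mul_smul, hX, smul_sub, map_sub, hp _ (Q.smul_mem _ hq), smul_comm, map_smul, hp q hq,
        hΨ q hq, smul_eq_mul, map_mul, constantCoeff_X]
      ring
  have hspan : ∀ w ∈ Submodule.span (MvPolynomial (Fin n) F)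
      ((fun (q : Fin k → MvPolynomial (Fin n) K) j => taylorHom ξ (q j)) '' Q),
      ∀ p : MvPolynomial (Fin n) F, Ψ (p • w) = constantCoeff p * Ψ w := by
    intro w hw
    induction hw using Submodule.span_induction with
    | mem w hw =>
      obtain ⟨q, hq, rfl⟩ := hw
      exact fun p => hgen p q hq
    | zero => simp
    | add w w' _ _ h h' =>
      intro p
      rw [smul_add, map_add, h, h', map_add, mul_add]
    | smul a w _ h =>
      intro p
      rw [smul_smul, h, h, map_mul, mul_assoc]
  intro w hw
  induction hw using Submodule.smul_induction_on' with
  | smul p hp w hw =>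
    have h0 : constantCoeff p = 0 := by
      have := (mem_pow_idealOfVars_iff' 1 p).1 (by simpa using hp) 0 (by simp)
      rwa [constantCoeff_eq]
    rw [hspan w hw, h0, zero_mul]
  | add w _ w' _ h h' => rw [map_add, h, h', add_zero]

/-- A functional of finite order at the origin depends on finitely many coefficients. -/
theorem exists_coeff_formula (r : ℕ) (Φ : (Fin k → MvPolynomial (Fin n) F) →ₗ[F] F)
    (hΦ : ∀ w ∈ (idealOfVars (Fin n) F ^ r • ⊤ :
      Submodule (MvPolynomial (Fin n) F) (Fin k → MvPolynomial (Fin n) F)), Φ w = 0) :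
    ∃ T : Finset (Fin n →₀ ℕ), ∀ w, Φ w =
      ∑ j, ∑ α ∈ T, Φ (Pi.single j (monomial α 1)) * coeff α (w j) := by
  classical
  have hfin : {α : Fin n →₀ ℕ | α.degree < r}.Finite := Finsupp.finite_of_degree_lt r
  refine ⟨hfin.toFinset, fun w => ?_⟩
  have hone : ∀ (j : Fin k) (p : MvPolynomial (Fin n) F), Φ (Pi.single j p) =
      ∑ α ∈ hfin.toFinset, Φ (Pi.single j (monomial α 1)) * coeff α p := by
    intro j p
    induction p using MvPolynomial.induction_on' with
    | add p q hp hq => simp [Pi.single_add, hp, hq, mul_add, Finset.sum_add_distrib]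
    | monomial β a =>
      have ha : Φ (Pi.single j (monomial β a)) = a * Φ (Pi.single j (monomial β 1)) := by
        rw [← smul_eq_mul, ← map_smul, ← Pi.single_smul, smul_monomial, smul_eq_mul, mul_one]
      simp only [coeff_monomial, mul_ite, mul_zero, Finset.sum_ite_eq, Set.Finite.mem_toFinset,
        Set.mem_ofPred_eq]
      split_ifs with h
      · rw [ha, mul_comm]
      · have hmem : (Pi.single j (monomial β 1) : Fin k → MvPolynomial (Fin n) F) ∈
            (idealOfVars (Fin n) F ^ r • ⊤ : Submodule (MvPolynomial (Fin n) F) _) := by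
          have := Submodule.smul_mem_smul (N := (⊤ : Submodule (MvPolynomial (Fin n) F)
            (Fin k → MvPolynomial (Fin n) F)))
            ((monomial_mem_pow_idealOfVars_iff r β (one_ne_zero (α := F))).2 (not_lt.1 h))
            (Submodule.mem_top (x := Pi.single j 1))
          rwa [← Pi.single_smul, smul_eq_mul, mul_one] at this
        rw [ha, hΦ _ hmem, mul_zero]
  conv_lhs => rw [← Finset.univ_sum_single w, map_sum]
  exact Finset.sum_congr rfl fun j _ => hone j (w j)

/-- A `K[x]`-linear map from a submodule of `K[x]^k` to a field `F`, on which `K[x]` acts through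
the point `ξ`, is the restriction of a differential operator with coefficients in `F`. -/
theorem exists_differential_extension [CharZero K] (ξ : Fin n → F)
    (Q : Submodule (MvPolynomial (Fin n) K) (Fin k → MvPolynomial (Fin n) K))
    (φ : Q.restrictScalars K →ₗ[K] F)
    (hφ : ∀ (i : Fin n) (q : Q), φ ((X i : MvPolynomial (Fin n) K) • q : Q) = ξ i * φ q) :
    ∃ c : Fin k → MvPolynomial (Fin n) F, ∀ q : Q,
      φ q = ∑ j, ∑ α ∈ (c j).support,
        coeff α (c j) * aeval ξ (ipdP α ((q : Fin k → MvPolynomial (Fin n) K) j)) := by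
  classical
  obtain ⟨ψ, hψ⟩ := LinearMap.exists_extend φ
  have hψ' : ∀ q : Q, ψ q = φ q := fun q => LinearMap.congr_fun hψ q
  obtain ⟨Ψ, hΨ⟩ := exists_linearMap_pi_taylorHom ξ ψ
  obtain ⟨r, Φ, hΦ, hΦ0⟩ := exists_dual_vanishing_pow (idealOfVars (Fin n) F) _ Ψ
    (taylorHom_smul_vanishing ξ Q Ψ fun q hq i => by
      rw [hΨ, hΨ, hψ' ⟨q, hq⟩, ← hφ i ⟨q, hq⟩, ← hψ']
      rfl)
  obtain ⟨T, hT⟩ := exists_coeff_formula r Φ hΦ0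
  choose u hu hu' using exists_aeval_ipdP (A := K) ξ
  have : CharZero F := charZero_of_injective_algebraMap (algebraMap K F).injective
  refine ⟨fun j => ∑ α ∈ T, monomial α (Φ (Pi.single j (monomial α 1)) / u α), fun q => ?_⟩
  have hc : ∀ j α, coeff α (∑ α ∈ T, monomial α (Φ (Pi.single j (monomial α 1)) / (u α : F))) =
      if α ∈ T then Φ (Pi.single j (monomial α 1)) / u α else 0 := fun j α => by
    simp [coeff_sum, coeff_monomial]
  rw [← hψ', ← hΨ, ← hΦ _ (Submodule.subset_span ⟨q, q.2, rfl⟩), hT]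
  refine Finset.sum_congr rfl fun j _ => ?_
  rw [Finset.sum_subset (s₁ := support _) (s₂ := T)]
  · refine Finset.sum_congr rfl fun α hα => ?_
    rw [hc, if_pos hα, hu']
    field_simp [Nat.cast_ne_zero.2 (hu α)]
  · intro α hα
    by_contra h
    rw [mem_support_iff, hc, if_neg h] at hα
    exact hα rfl
  · intro α _ hα
    rw [notMem_support_iff.1 hα, zero_mul]

end Operators

end MvPolynomial

theorem exists_noethAct_mem_iff {n k : ℕ} {K : Type*} [Field K]
    (P : Ideal (MvPolynomial (Fin n) K)) [P.IsPrime]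
    (c : Fin k → MvPolynomial (Fin n) P.ResidueField) :
    ∃ B : Fin k → MvPolynomial (Fin n) (MvPolynomial (Fin n) K), ∀ m, NoethAct B m ∈ P ↔
      ∑ j, ∑ α ∈ (c j).support, coeff α (c j) *
        algebraMap (MvPolynomial (Fin n) K) P.ResidueField (ipdP α (m j)) = 0 := by
  classical
  obtain ⟨b, hb⟩ := IsLocalization.exist_integer_multiples_of_finset
    (nonZeroDivisors (MvPolynomial (Fin n) K ⧸ P))
    (Finset.univ.biUnion fun j => (c j).support.image fun α => coeff α (c j))
  set u : P.ResidueField := algebraMap (MvPolynomial (Fin n) K ⧸ P) P.ResidueField b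
  have hu0 : u ≠ 0 := IsLocalization.to_map_ne_zero_of_mem_nonZeroDivisors _ le_rfl b.2
  have hlift : ∀ j α, ∃ a : MvPolynomial (Fin n) K,
      algebraMap _ P.ResidueField a = u * coeff α (c j) := by
    intro j α
    by_cases hα : α ∈ (c j).support
    · obtain ⟨y, hy⟩ := hb (coeff α (c j)) (Finset.mem_biUnion.2
        ⟨j, Finset.mem_univ _, Finset.mem_image_of_mem _ hα⟩)
      obtain ⟨a, rfl⟩ := Ideal.Quotient.mk_surjective y
      exact ⟨a, by rw [← Ideal.algebraMap_quotient_residueField_mk, hy, Algebra.smul_def]⟩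
    · exact ⟨0, by rw [notMem_support_iff.1 hα]; simp⟩
  choose a ha using hlift
  refine ⟨fun j => ∑ α ∈ (c j).support, monomial α (a j α), fun m => ?_⟩
  have hc : ∀ j α, coeff α (∑ α ∈ (c j).support, monomial α (a j α)) =
      if α ∈ (c j).support then a j α else 0 := fun j α => by
    simp only [coeff_sum, coeff_monomial, Finset.sum_ite_eq']
  suffices h : algebraMap _ P.ResidueField
      (NoethAct (fun j => ∑ α ∈ (c j).support, monomial α (a j α)) m) =
      u * ∑ j, ∑ α ∈ (c j).support, coeff α (c j) *
        algebraMap (MvPolynomial (Fin n) K) P.ResidueField (ipdP α (m j)) by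
    rw [← Ideal.algebraMap_residueField_eq_zero, h, mul_eq_zero, or_iff_right hu0]
  rw [NoethAct, map_sum, Finset.mul_sum]
  refine Finset.sum_congr rfl fun j _ => ?_
  rw [Finset.sum_subset (s₁ := support _) (s₂ := (c j).support), map_sum, Finset.mul_sum]
  · refine Finset.sum_congr rfl fun α hα => ?_
    rw [hc, if_pos hα, map_mul, ha, mul_assoc]
  · intro α hα
    by_contra h
    rw [mem_support_iff, hc, if_neg h] at hα
    exact hα rfl
  · intro α _ hα
    rw [notMem_support_iff.1 hα, zero_mul]

section Length

open IsLocalRing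

variable {A V : Type*} [CommRing A] [IsLocalRing A] [AddCommGroup V] [Module A V]

theorem CovBy.exists_residueField_functional {U W : Submodule A V} (h : U ⋖ W) :
    ∃ φ : W →ₗ[A] ResidueField A, ∀ w, φ w = 0 ↔ (w : V) ∈ U := by
  have := (covBy_iff_quot_is_simple h.le).1 h
  obtain ⟨I, hI, ⟨e⟩⟩ := isSimpleModule_iff_quot_maximal.1 this
  obtain rfl := eq_maximalIdeal hI
  refine ⟨e.toLinearMap ∘ₗ (Submodule.comap W.subtype U).mkQ, fun w => ?_⟩
  refine (e.map_eq_zero_iff (x := Submodule.Quotient.mk w)).trans ?_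
  rw [Submodule.Quotient.mk_eq_zero]
  rfl

/-- A composition series of a submodule of finite length, together with functionals to the residue
field cutting out its steps. -/
theorem exists_filtration_residueField (L : Submodule A V) [IsNoetherian A L] [IsArtinian A L] :
    ∃ (l : ℕ) (W : Fin (l + 1) → Submodule A V),
      (l : WithBot ℕ∞) = Order.krullDim (Submodule A L) ∧ StrictMono W ∧ W 0 = ⊥ ∧
      W (Fin.last l) = L ∧ ∀ t : Fin l, ∃ φ : W t.succ →ₗ[A] ResidueField A,
        ∀ w, φ w = 0 ↔ (w : V) ∈ W t.castSucc := by
  obtain ⟨s, hs₀, hs₁⟩ := exists_compositionSeries_of_isNoetherian_isArtinian A L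
  refine ⟨s.length, fun t => (s t).map L.subtype, ?_, ?_, ?_, ?_, fun t => ?_⟩
  · rw [← Module.coe_length, ← Module.length_compositionSeries s hs₀ hs₁]
    rfl
  · exact (Submodule.map_strictMono_of_injective L.injective_subtype).comp s.strictMono
  · change (s 0).map L.subtype = ⊥
    rw [show s 0 = ⊥ from hs₀, Submodule.map_bot]
  · change (s (Fin.last s.length)).map L.subtype = L
    rw [show s (Fin.last s.length) = ⊤ from hs₁, Submodule.map_top, Submodule.range_subtype]
  · obtain ⟨φ, hφ⟩ := (s.step t).exists_residueField_functional
    let e := Submodule.equivMapOfInjective L.subtype L.injective_subtype (s t.succ)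
    refine ⟨φ ∘ₗ e.symm.toLinearMap, fun w => ?_⟩
    obtain ⟨v, rfl⟩ := e.surjective w
    simp [hφ, e]

theorem isArtinian_of_pow_maximalIdeal_le [IsNoetherianRing A] [Module.Finite A V] (r : ℕ)
    (h : Module.IsTorsionBySet A V ((maximalIdeal A ^ r : Ideal A) : Set A)) :
    IsArtinian A V := by
  have : Ring.KrullDimLE 0 (A ⧸ maximalIdeal A ^ r) := by
    refine .mk₀ fun Q hQ => ?_
    have hle : maximalIdeal A ≤ Q.comap (Ideal.Quotient.mk _) := by
      refine Ideal.IsPrime.le_of_pow_le (n := r) ?_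
      intro x hx
      rw [Ideal.mem_comap, Ideal.Quotient.eq_zero_iff_mem.2 hx]
      exact Q.zero_mem
    have hmax : (Q.comap (Ideal.Quotient.mk (maximalIdeal A ^ r))).IsMaximal := by
      rw [← (maximalIdeal.isMaximal A).eq_of_le (Ideal.IsPrime.ne_top inferInstance) hle]
      exact maximalIdeal.isMaximal A
    exact Ideal.isMaximal_of_isIntegral_of_isMaximal_comap' (Ideal.Quotient.mk _)
      (RingHom.isIntegral_of_surjective _ Ideal.Quotient.mk_surjective) Q hmax
  have : IsArtinianRing (A ⧸ maximalIdeal A ^ r) :=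
    IsNoetherianRing.isArtinianRing_of_krullDimLE_zero
  let := h.module
  have : Module.Finite (A ⧸ maximalIdeal A ^ r) V :=
    Module.Finite.of_restrictScalars_finite A _ _
  exact (h.semilinearMap.isArtinian_iff_of_bijective Function.bijective_id).2 inferInstance

theorem isArtinian_iSup_torsionBySet_pow [IsNoetherianRing A] [Module.Finite A V]
    {I : Ideal A} (hI : I = maximalIdeal A) :
    IsArtinian A ↥(⨆ r : ℕ, Submodule.torsionBySet A V ((I ^ r : Ideal A) : Set A)) := by
  subst hI
  let a : ℕ →o Submodule A V :=
    ⟨fun r => Submodule.torsionBySet A V ((maximalIdeal A ^ r : Ideal A) : Set A),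
      fun r r' h => Submodule.torsionBySet_le_torsionBySet_of_subset (Ideal.pow_le_pow_right h)⟩
  have ha : (⨆ r, a r) = a (monotonicSequenceLimitIndex a) :=
    WellFoundedGT.iSup_eq_monotonicSequenceLimit a
  change IsArtinian A ↥(⨆ r, a r)
  rw [ha]
  exact isArtinian_of_pow_maximalIdeal_le _ (Submodule.torsionBySet_isTorsionBySet _)

end Length

/-- The image of `x` in the localization at a minimal prime of its annihilator is torsion with
respect to the powers of the maximal ideal. -/
theorem mk_mem_iSup_torsionBySet_of_mem_minimalPrimes {R N : Type*} [CommRing R]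
    [IsNoetherianRing R] [AddCommGroup N] [Module R N] (P : Ideal R) [P.IsPrime] (x : N)
    (hP : P ∈ (Ideal.torsionOf R N x).minimalPrimes) :
    LocalizedModule.mkLinearMap P.primeCompl N x ∈
      ⨆ r : ℕ, Submodule.torsionBySet (Localization P.primeCompl)
        (LocalizedModule P.primeCompl N)
        (((P.map (algebraMap R (Localization P.primeCompl))) ^ r :
          Ideal (Localization P.primeCompl)) : Set (Localization P.primeCompl)) := by
  set A := Localization P.primeCompl
  have hrad : P.map (algebraMap R A) ≤ ((Ideal.torsionOf R N x).map (algebraMap R A)).radical := by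
    rw [Ideal.radical_eq_sInf, le_sInf_iff]
    rintro Q ⟨hQ, hQp⟩
    have hcomap := (IsLocalization.isPrime_iff_isPrime_disjoint P.primeCompl A Q).1 hQp
    rw [Ideal.map_le_iff_le_comap] at hQ ⊢
    refine hP.2 ⟨hcomap.1, hQ⟩ fun y hy => ?_
    by_contra hyP
    exact Set.disjoint_left.1 hcomap.2 hyP hy
  obtain ⟨r, hr⟩ := Ideal.exists_pow_le_of_le_radical_of_fg hrad (IsNoetherian.noetherian _)
  refine Submodule.mem_iSup_of_mem r ((Submodule.mem_torsionBySet_iff _ _).2 fun a => ?_)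
  have hle : (Ideal.torsionOf R N x).map (algebraMap R A) ≤
      Ideal.torsionOf A _ (LocalizedModule.mkLinearMap P.primeCompl N x) := by
    rw [Ideal.map_le_iff_le_comap]
    intro y hy
    rw [Ideal.mem_comap, Ideal.mem_torsionOf_iff, algebraMap_smul, ← map_smul,
      (Ideal.mem_torsionOf_iff x y).1 hy, map_zero]
  exact (Ideal.mem_torsionOf_iff _ _).1 (hle (hr a.2))

theorem mkLinearMap_ne_zero_of_torsionOf_le {R N : Type*} [CommRing R]
    [AddCommGroup N] [Module R N] (P : Ideal R) [P.IsPrime] (x : N)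
    (hP : Ideal.torsionOf R N x ≤ P) : LocalizedModule.mkLinearMap P.primeCompl N x ≠ 0 := by
  intro h
  obtain ⟨c, hc⟩ := (IsLocalizedModule.eq_zero_iff P.primeCompl _).1 h
  exact c.2 (hP ((Ideal.mem_torsionOf_iff x _).2 hc))

theorem exists_linearMap_comap_residueField {R U V : Type*} [CommRing R] (P : Ideal R) [P.IsPrime]
    [AddCommGroup U] [Module R U] [AddCommGroup V] [Module R V]
    [Module (Localization P.primeCompl) V] [IsScalarTower R (Localization P.primeCompl) V]
    (f : U →ₗ[R] V) (W : Submodule (Localization P.primeCompl) V)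
    (φ : W →ₗ[Localization P.primeCompl] IsLocalRing.ResidueField (Localization P.primeCompl)) :
    ∃ ψ : (W.restrictScalars R).comap f →ₗ[R] P.ResidueField, ∀ u, ψ u = φ ⟨f u, u.2⟩ :=
  have : IsScalarTower R (Localization P.primeCompl)
      (IsLocalRing.ResidueField (Localization P.primeCompl)) :=
    inferInstanceAs (IsScalarTower R (Localization.AtPrime P) P.ResidueField)
  ⟨φ.restrictScalars R ∘ₗ f.submoduleComap (W.restrictScalars R), fun _ => rfl⟩

section Multipliers

variable {n k : ℕ} {K : Type*} [Field K] [CharZero K]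

/-- A `K[x]`-linear map from a submodule of `K[x]^k` to the residue field at a prime `P` has the
same zeros as a differential operator with polynomial coefficients, modulo `P`. -/
theorem exists_noethAct_mem_iff_eq_zero (P : Ideal (MvPolynomial (Fin n) K)) [P.IsPrime]
    (Q : Submodule (MvPolynomial (Fin n) K) (Fin k → MvPolynomial (Fin n) K))
    (φ : Q →ₗ[MvPolynomial (Fin n) K] P.ResidueField) :
    ∃ B : Fin k → MvPolynomial (Fin n) (MvPolynomial (Fin n) K),
      ∀ q : Q, NoethAct B q ∈ P ↔ φ q = 0 := by
  let ξ : Fin n → P.ResidueField := fun i => algebraMap (MvPolynomial (Fin n) K) _ (X i)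
  have hξ : ∀ p : MvPolynomial (Fin n) K, aeval ξ p = algebraMap _ P.ResidueField p := by
    intro p
    have : aeval ξ = IsScalarTower.toAlgHom K (MvPolynomial (Fin n) K) P.ResidueField := by
      ext i
      simp [ξ]
    rw [this]
    rfl
  obtain ⟨c, hc⟩ := exists_differential_extension ξ Q (φ.restrictScalars K) fun i q => by
    change φ (X i • q) = _ * φ q
    rw [map_smul, Algebra.smul_def]
  obtain ⟨B, hB⟩ := exists_noethAct_mem_iff P c
  refine ⟨B, fun q => ?_⟩
  have hq : φ q = _ := hc q
  rw [hB, hq]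
  simp_rw [hξ]

theorem exists_finset_multipliers (P : Ideal (MvPolynomial (Fin n) K)) (hP : P.IsPrime)
    (M : Submodule (MvPolynomial (Fin n) K) (Fin k → MvPolynomial (Fin n) K)) :
    ∃ 𝒜 : Finset (Fin k → MvPolynomial (Fin n) (MvPolynomial (Fin n) K)),
      ((𝒜.card : WithBot ℕ∞) = arithLength (MvPolynomial (Fin n) K)
        ((Fin k → MvPolynomial (Fin n) K) ⧸ M) P hP) ∧
      (∀ m ∈ M, ∀ B ∈ 𝒜, NoethAct B m ∈ P) ∧
      ∀ m, P ∈ (Ideal.torsionOf (MvPolynomial (Fin n) K) _ (M.mkQ m)).minimalPrimes →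
        ¬ ∀ B ∈ 𝒜, NoethAct B m ∈ P := by
  classical
  let R := MvPolynomial (Fin n) K
  let A := Localization P.primeCompl
  let V := LocalizedModule P.primeCompl ((Fin k → R) ⧸ M)
  let f : (Fin k → R) →ₗ[R] V := LocalizedModule.mkLinearMap P.primeCompl _ ∘ₗ M.mkQ
  have hsurj : ∀ v : V, ∃ q, ∃ s : P.primeCompl, f q = s • v := by
    intro v
    obtain ⟨⟨x, s⟩, hx⟩ := IsLocalizedModule.surj P.primeCompl
      (LocalizedModule.mkLinearMap P.primeCompl ((Fin k → R) ⧸ M)) v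
    obtain ⟨q, rfl⟩ := M.mkQ_surjective x
    exact ⟨q, s, hx.symm⟩
  have hI : P.map (algebraMap R A) = IsLocalRing.maximalIdeal A :=
    Localization.AtPrime.map_eq_maximalIdeal
  have : IsNoetherianRing A := IsLocalization.isNoetherianRing P.primeCompl A inferInstance
  have : Module.Finite A V := inferInstance
  have := isArtinian_iSup_torsionBySet_pow (V := V) hI
  obtain ⟨l, W, hl, hW, hW₀, hW₁, hφ⟩ := exists_filtration_residueField
    (⨆ r : ℕ, Submodule.torsionBySet A V ((P.map (algebraMap R A) ^ r : Ideal A) : Set A))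
  have hB : ∀ t : Fin l, ∃ B : Fin k → MvPolynomial (Fin n) (MvPolynomial (Fin n) K),
      ∀ q, f q ∈ W t.succ → (NoethAct B q ∈ P ↔ f q ∈ W t.castSucc) := by
    intro t
    obtain ⟨φ, hφ⟩ := hφ t
    obtain ⟨ψ, hψ⟩ := exists_linearMap_comap_residueField P f (W t.succ) φ
    obtain ⟨B, hB⟩ := exists_noethAct_mem_iff_eq_zero P _ ψ
    refine ⟨B, fun q hq => (hB ⟨q, hq⟩).trans ?_⟩
    rw [hψ]
    exact hφ ⟨f q, hq⟩
  choose B hB using hB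
  have hinj : Function.Injective B := by
    refine Function.Injective.of_lt_imp_ne fun t t' htt' h => ?_
    obtain ⟨v, hv, hv'⟩ := SetLike.exists_of_lt (hW t.castSucc_lt_succ)
    obtain ⟨q, s, hq⟩ := hsurj v
    have hs : f q = algebraMap R A s • v := by
      rw [hq, algebraMap_smul]
      rfl
    have hu : IsUnit (algebraMap R A s) := IsLocalization.map_units A s
    have hq₁ : f q ∈ W t.succ := hs ▸ (W t.succ).smul_mem _ hv
    have hq₂ : f q ∉ W t.castSucc := by
      rw [hs]
      exact fun h => hv' ((Submodule.smul_mem_iff_of_isUnit _ hu).1 h)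
    have hq₃ : f q ∈ W t'.castSucc := hW.monotone (by exact htt') hq₁
    have hq₄ : f q ∈ W t'.succ := hW.monotone t'.castSucc_lt_succ.le hq₃
    exact hq₂ ((hB t q hq₁).1 (h ▸ (hB t' q hq₄).2 hq₃))
  refine ⟨Finset.univ.map ⟨B, hinj⟩, ?_, ?_, ?_⟩
  · rw [Finset.card_map, Finset.card_fin]
    exact hl
  · intro m hm b hb
    obtain ⟨t, -, rfl⟩ := Finset.mem_map.1 hb
    have h0 : f m = 0 := by
      have : M.mkQ m = 0 := by simpa using hm
      simp [f, this]
    exact (hB t m (h0 ▸ zero_mem _)).2 (h0 ▸ zero_mem _)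
  · intro m hm hall
    have hmem : ∀ t, f m ∈ W t := by
      intro t
      induction t using Fin.reverseInduction with
      | last => exact hW₁ ▸ mk_mem_iSup_torsionBySet_of_mem_minimalPrimes P _ hm
      | cast t ih => exact (hB t m ih).1 (hall _ (Finset.mem_map.2 ⟨t, Finset.mem_univ _, rfl⟩))
    have h0 := hmem 0
    rw [hW₀, Submodule.mem_bot] at h0
    exact mkLinearMap_ne_zero_of_torsionOf_le P _ hm.1.2 h0

end Multipliers

theorem exists_minimalPrimes_torsionOf_mem_associatedPrimes {R N : Type*} [CommRing R]
    [IsNoetherianRing R] [AddCommGroup N] [Module R N] {x : N} (hx : x ≠ 0) :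
    ∃ P ∈ (Ideal.torsionOf R N x).minimalPrimes, P ∈ associatedPrimes R N := by
  have hne : Ideal.torsionOf R N x ≠ ⊤ := by rwa [Ne, Ideal.torsionOf_eq_top_iff]
  obtain ⟨P, hP⟩ := Ideal.nonempty_minimalPrimes hne
  have hann : Module.annihilator R (Submodule.span R {x}) = Ideal.torsionOf R N x :=
    Ideal.annihilator_span_singleton_eq_torsionOf x
  refine ⟨P, hP, ?_⟩
  exact associatedPrimes.subset_of_injective (Submodule.injective_subtype _)
    (Module.associatedPrimes.minimalPrimes_annihilator_subset_associatedPrimes R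
      (Submodule.span R {x}) (hann ▸ hP))

/-- every submodule `M ⊆ R^k` over `R = K[x₁,…,xₙ]`, `K` a subfield of `ℂ`,
admits a differential primary decomposition: finite sets `𝒜₁,…,𝒜_s` of Noetherian
multipliers, one for each associated prime `P_i` of `R^k/M`, testing membership in `M`,
with `|𝒜_i|` equal to the arithmetic length of `M` along `P_i`. -/
theorem stmt12 {n k s : ℕ} (K : Subfield ℂ)
    (M : Submodule (MvPolynomial (Fin n) K) (Fin k → MvPolynomial (Fin n) K))
    (P : Fin s → Ideal (MvPolynomial (Fin n) K))
    (hprime : ∀ i, (P i).IsPrime)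
    (hinj : Function.Injective P)
    (hass : associatedPrimes (MvPolynomial (Fin n) K)
        ((Fin k → MvPolynomial (Fin n) K) ⧸ M) = Set.range P) :
    ∃ 𝒜 : Fin s → Finset (Fin k → MvPolynomial (Fin n) (MvPolynomial (Fin n) K)),
      (∀ m : Fin k → MvPolynomial (Fin n) K,
        m ∈ M ↔ ∀ i, ∀ B ∈ 𝒜 i, NoethAct B m ∈ P i) ∧
      (∀ i, ((𝒜 i).card : WithBot ℕ∞)
        = arithLength (MvPolynomial (Fin n) K)
            ((Fin k → MvPolynomial (Fin n) K) ⧸ M) (P i) (hprime i)) := by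
  choose 𝒜 hcard hM hmin using fun i => exists_finset_multipliers (P i) (hprime i) M
  refine ⟨𝒜, fun m => ⟨fun hm i => hM i m hm, fun h => ?_⟩, hcard⟩
  by_contra hm
  have hx : M.mkQ m ≠ 0 := by simpa using hm
  obtain ⟨Q, hQ, hQass⟩ := exists_minimalPrimes_torsionOf_mem_associatedPrimes
    (R := MvPolynomial (Fin n) K) hx
  rw [hass] at hQass
  obtain ⟨i, rfl⟩ := hQass
  exact hmin i m hQ (h i)
end

section
/- Let K be a subfield of ℂ, R = K[x₁,…,xₙ], M ⊆ R^k a submodule with associated primes P₁,…,P_s, and for each i let S_i ⊆ {x₁,…,xₙ} be a maximal subset of variables with K[S_i] ∩ P_i = {0}. Then: (a) the finite sets 𝒜₁,…,𝒜_s of a differential primary decomposition of M can be chosen so that each element of 𝒜_i involves only the variables z_j with x_j ∉ S_i (besides the x-variables); and (b) for any finite sets 𝒜_i ⊆ K[x₁,…,xₙ][z_j : x_j ∉ S_i]^k (i = 1,…,s) satisfying M = { m ∈ R^k : B•m ∈ P_i for all B ∈ 𝒜_i and all i }, the cardinality of 𝒜_i is at least the arithmetic length of M along P_i. -/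
set_option synthInstance.maxHeartbeats 1000000
set_option maxHeartbeats 1000000

open MvPolynomial

section Taylor

variable {K : Type*} [Field K] {n : ℕ}

theorem pderiv_iterate_monomial (i : Fin n) (a : ℕ) (β : Fin n →₀ ℕ) (c : K) :
    (fun g => (pderiv i) g)^[a] (monomial β c) =
      monomial (β - Finsupp.single i a) (c * (β i).descFactorial a) := by
  induction a with
  | zero => simp
  | succ a ih =>
    rw [Function.iterate_succ_apply', ih]
    simp only [pderiv_monomial]
    congr 1
    · rw [tsub_tsub, ← Finsupp.single_add]
    · rw [Nat.descFactorial_succ]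
      push_cast [Finsupp.tsub_apply, Finsupp.single_eq_same]
      ring

theorem pderiv_iterate_add (i : Fin n) (a : ℕ) (p q : MvPolynomial (Fin n) K) :
    (fun g => (pderiv i) g)^[a] (p + q) =
      (fun g => (pderiv i) g)^[a] p + (fun g => (pderiv i) g)^[a] q := by
  induction a generalizing p q with
  | zero => rfl
  | succ a ih => simp

theorem ipdP_add (α : Fin n → ℕ) (p q : MvPolynomial (Fin n) K) :
    ipdP α (p + q) = ipdP α p + ipdP α q := by
  unfold ipdP
  rw [List.ofFn_eq_map]
  induction List.finRange n with
  | nil => rfl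
  | cons i l ih =>
    simp only [List.map_cons, List.foldr_cons, Function.comp_apply] at ih ⊢
    rw [ih, pderiv_iterate_add]

theorem ipdP_monomial (α : Fin n → ℕ) (β : Fin n →₀ ℕ) (c : K) :
    ipdP α (monomial β c) =
      monomial (β - Finsupp.equivFunOnFinite.symm α)
        (c * ∏ i, ((β i).descFactorial (α i) : K)) := by
  have key : ∀ l : List (Fin n), l.Nodup →
      ((l.map fun i : Fin n => (fun g : MvPolynomial (Fin n) K =>
        (pderiv i) g)^[α i]).foldr (· ∘ ·) id) (monomial β c) =
      monomial (β - ∑ i ∈ l.toFinset, Finsupp.single i (α i))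
        (c * ∏ i ∈ l.toFinset, ((β i).descFactorial (α i) : K)) := by
    intro l hl
    induction l with
    | nil => simp
    | cons i l ih =>
      rw [List.nodup_cons] at hl
      simp only [List.map_cons, List.foldr_cons, Function.comp_apply]
      rw [ih hl.2, pderiv_iterate_monomial]
      have hi : i ∉ l.toFinset := by simpa using hl.1
      rw [List.toFinset_cons, Finset.sum_insert hi, Finset.prod_insert hi]
      have h0 : (∑ j ∈ l.toFinset, Finsupp.single j (α j)) i = 0 := by
        rw [Finsupp.finsetSum_apply]
        refine Finset.sum_eq_zero fun j hj => ?_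
        rw [Finsupp.single_apply, if_neg]
        rintro rfl
        exact hi hj
      congr 1
      · rw [tsub_tsub, add_comm]
      · rw [Finsupp.tsub_apply, h0, Nat.sub_zero]
        ring
  unfold ipdP
  rw [List.ofFn_eq_map, key _ (List.nodup_finRange n)]
  have : (List.finRange n).toFinset = Finset.univ := by ext; simp
  rw [this]
  congr 2
  ext i
  simp [Finsupp.single_apply]

variable {κ : Type*} [Field κ] [CharZero κ] {C' : Type*} [CommRing C']

/-- Taylor expansion at the point `ρ X` of `MvPolynomial (Fin n) K`, evaluated at a nilpotent
displacement `h`. -/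
theorem taylor_nilpotent (ρ : MvPolynomial (Fin n) K →+* κ) (θ : κ →+* C')
    (g : MvPolynomial (Fin n) K →+* C') (h : Fin n → C') (N : ℕ)
    (hgC : ∀ a, g (C a) = θ (ρ (C a))) (hgX : ∀ i, g (X i) = θ (ρ (X i)) + h i)
    (hN : ∀ i, h i ^ N = 0) (m : MvPolynomial (Fin n) K) :
    g m = ∑ α ∈ Fintype.piFinset (fun _ : Fin n => Finset.range N),
      (∏ i, h i ^ α i) * θ (ρ (ipdP α m) / ∏ i, ((α i).factorial : κ)) := by
  induction m using MvPolynomial.induction_on' with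
  | add p q hp hq =>
    simp only [ipdP_add, map_add, add_div, mul_add, Finset.sum_add_distrib, hp, hq]
  | monomial β c =>
    have e1 : ∀ i, (θ (ρ (X i)) + h i) ^ β i =
        ∑ a ∈ Finset.range N,
          h i ^ a * θ (ρ (X i) ^ (β i - a) * ((β i).choose a : κ)) := by
      intro i
      rw [add_comm, add_pow]
      have e2 : ∑ a ∈ Finset.range (β i + 1),
          h i ^ a * θ (ρ (X i)) ^ (β i - a) * ((β i).choose a : C') =
          ∑ a ∈ Finset.range (max N (β i + 1)),
          h i ^ a * θ (ρ (X i)) ^ (β i - a) * ((β i).choose a : C') := by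
        refine Finset.sum_subset (by simp) fun a _ ha => ?_
        rw [Nat.choose_eq_zero_of_lt (by simpa using ha)]
        simp
      rw [e2]
      symm
      refine (Finset.sum_subset (by simp) fun a _ ha => ?_).trans
        (Finset.sum_congr rfl fun a _ => ?_)
      · have : N ≤ a := by simpa using ha
        rw [pow_eq_zero_of_le this (hN i), zero_mul]
      · simp [mul_assoc]
    have e3 : g (monomial β c) = θ (ρ (C c)) * ∏ i, (θ (ρ (X i)) + h i) ^ β i := by
      rw [monomial_eq, map_mul, hgC, Finsupp.prod_fintype _ _ (by simp), map_prod]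
      simp [hgX]
    rw [e3, Finset.prod_congr rfl fun i _ => e1 i, Finset.prod_univ_sum, Finset.mul_sum]
    refine Finset.sum_congr rfl fun α _ => ?_
    rw [Finset.prod_mul_distrib, mul_left_comm, ← map_prod, ← map_mul, ipdP_monomial]
    congr 2
    have hD : ∏ i, ρ (C (((β i).descFactorial (α i) : ℕ) : K)) =
        (∏ i, ((α i).factorial : κ)) * ∏ i, ((β i).choose (α i) : κ) := by
      rw [← Finset.prod_mul_distrib]
      refine Finset.prod_congr rfl fun i _ => ?_
      rw [Nat.descFactorial_eq_factorial_mul_choose, map_natCast, map_natCast, Nat.cast_mul]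
    have hF : (∏ i, ((α i).factorial : κ)) ≠ 0 :=
      Finset.prod_ne_zero_iff.mpr fun i _ => by exact_mod_cast (α i).factorial_ne_zero
    rw [monomial_eq, map_mul, Finsupp.prod_fintype _ _ (by simp), map_prod, C_mul, map_mul,
      map_prod, map_prod, Finset.prod_mul_distrib, hD, eq_div_iff hF]
    simp only [map_pow, Finsupp.coe_tsub, Finsupp.coe_equivFunOnFinite_symm, Pi.sub_apply]
    ring

end Taylor

section Residue

variable {K : Type*} [Field K] {n : ℕ} (P : Ideal (MvPolynomial (Fin n) K)) [P.IsPrime]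

theorem exists_div_residueField (z : P.ResidueField) :
    ∃ a b : MvPolynomial (Fin n) K, b ∉ P ∧
      z = algebraMap _ P.ResidueField a / algebraMap _ P.ResidueField b := by
  obtain ⟨a, b, hb, rfl⟩ := IsFractionRing.div_surjective (MvPolynomial (Fin n) K ⧸ P) z
  obtain ⟨a, rfl⟩ := Ideal.Quotient.mk_surjective a
  obtain ⟨b, rfl⟩ := Ideal.Quotient.mk_surjective b
  refine ⟨a, b, fun h => ?_, rfl⟩
  rw [Ideal.Quotient.eq_zero_iff_mem.mpr h] at hb
  exact zero_notMem_nonZeroDivisors hb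

theorem charZero_residueField [CharZero K] : CharZero P.ResidueField :=
  charZero_of_injective_algebraMap (algebraMap K P.ResidueField).injective

variable {P} {S : Finset (Fin n)}

theorem algebraMap_supported_injective
    (hind : ∀ f ∈ P, f ∈ supported K (S : Set (Fin n)) → f = 0) :
    Function.Injective (algebraMap (supported K (S : Set (Fin n))) P.ResidueField) := by
  rw [injective_iff_map_eq_zero]
  intro f hf
  rw [IsScalarTower.algebraMap_apply _ (MvPolynomial (Fin n) K)] at hf
  exact Subtype.ext (hind f (Ideal.algebraMap_residueField_eq_zero.mp hf) f.2)

theorem exists_surjective_supported_adjoin {L : Type*} [Field L] [Algebra K L] (x : Fin n → L)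
    (T : Set (Fin n)) : ∃ ψ : supported K T →ₐ[K] Algebra.adjoin K (x '' T),
      Function.Surjective ψ ∧ ∀ f, (ψ f : L) = aeval x (f : MvPolynomial (Fin n) K) := by
  have hmap : (supported K T).map (aeval x) = Algebra.adjoin K (x '' T) := by
    rw [supported, AlgHom.map_adjoin, ← Set.image_comp]
    congr 2
    ext i
    simp
  refine ⟨((aeval x).comp (supported K T).val).codRestrict _ fun f => ?_, ?_, fun f => rfl⟩
  · rw [← hmap]
    exact ⟨f, f.2, rfl⟩
  · rintro ⟨y, hy⟩
    rw [← hmap] at hy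
    obtain ⟨f, hf, hy⟩ := hy
    exact ⟨⟨f, hf⟩, Subtype.ext hy⟩

theorem isAlgebraic_of_maximal_independent {L : Type*} [Field L]
    [Algebra (MvPolynomial (Fin n) K) L] [Algebra K L] [IsScalarTower K (MvPolynomial (Fin n) K) L]
    (hdiv : ∀ z : L, ∃ a b : MvPolynomial (Fin n) K, z = algebraMap _ L a / algebraMap _ L b)
    (hind : ∀ f : MvPolynomial (Fin n) K, algebraMap _ L f = 0 →
      f ∈ supported K (S : Set (Fin n)) → f = 0)
    (hmax : ∀ T : Finset (Fin n), S ⊆ T → (∀ f : MvPolynomial (Fin n) K, algebraMap _ L f = 0 →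
      f ∈ supported K (T : Set (Fin n)) → f = 0) → T = S) :
    Algebra.IsAlgebraic (supported K (S : Set (Fin n))) L := by
  let x : Fin n → L := fun i => algebraMap _ _ (X i : MvPolynomial (Fin n) K)
  have hx : ∀ f, aeval x f = algebraMap (MvPolynomial (Fin n) K) L f := by
    intro f
    have : aeval x = IsScalarTower.toAlgHom K (MvPolynomial (Fin n) K) L := by
      ext i
      simp [x]
    rw [this]
    rfl
  have hiff : ∀ T : Finset (Fin n), AlgebraicIndepOn K x (T : Set (Fin n)) ↔
      ∀ f : MvPolynomial (Fin n) K, algebraMap _ L f = 0 →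
        f ∈ supported K (T : Set (Fin n)) → f = 0 := by
    intro T
    have h := algebraicIndependent_comp_subtype (R := K) (x := x) (s := (T : Set (Fin n)))
    simp only [hx] at h
    refine Iff.trans h ?_
    exact forall_congr' fun f => ⟨fun h a b => h b a, fun h a b => h b a⟩
  have hS := (hiff S).mpr hind
  have hX : ∀ j, IsAlgebraic (supported K (S : Set (Fin n))) (x j) := by
    intro j
    by_cases hj : j ∈ S
    · exact isAlgebraic_algebraMap (A := L)
        (⟨X j, X_mem_supported.mpr hj⟩ : supported K (S : Set (Fin n)))
    · have h1 : ¬ AlgebraicIndepOn K x (insert j (S : Set (Fin n))) := by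
        intro h
        rw [← Finset.coe_insert, hiff] at h
        exact hj (hmax _ (Finset.subset_insert j S) h ▸ Finset.mem_insert_self j S)
      rw [AlgebraicIndepOn.insert_iff (by simpa using hj), not_and] at h1
      have h2 : IsAlgebraic (Algebra.adjoin K (x '' S)) (x j) := not_not.mp (h1 hS)
      obtain ⟨ψ, hψ, hψx⟩ :=
        exists_surjective_supported_adjoin (K := K) x (S : Set (Fin n))
      exact IsAlgebraic.of_ringHom_of_comp_eq (S := Algebra.adjoin K (x '' S)) (B := L) ψ
        (RingHom.id L) h2 hψ Function.injective_id
        (RingHom.ext fun f => (hψx f).trans (hx f))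
  have hR : ∀ f : MvPolynomial (Fin n) K,
      IsAlgebraic (supported K (S : Set (Fin n))) (algebraMap _ L f) := by
    intro f
    induction f using MvPolynomial.induction_on with
    | C a =>
      exact isAlgebraic_algebraMap (A := L)
        (algebraMap K (supported K (S : Set (Fin n))) a)
    | add p q hp hq => rw [map_add]; exact hp.add hq
    | mul_X p i hp => rw [map_mul]; exact hp.mul (hX i)
  refine ⟨fun z => ?_⟩
  obtain ⟨a, b, rfl⟩ := hdiv z
  rw [div_eq_mul_inv]
  exact (hR a).mul (hR b).inv

theorem isAlgebraic_residueField
    (hind : ∀ f ∈ P, f ∈ supported K (S : Set (Fin n)) → f = 0)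
    (hmax : ∀ T : Finset (Fin n), S ⊆ T →
      (∀ f ∈ P, f ∈ supported K (T : Set (Fin n)) → f = 0) → T = S) :
    Algebra.IsAlgebraic (supported K (S : Set (Fin n))) P.ResidueField :=
  isAlgebraic_of_maximal_independent
    (fun z => let ⟨a, b, _, h⟩ := exists_div_residueField P z; ⟨a, b, h⟩)
    (fun f hf => hind f (Ideal.algebraMap_residueField_eq_zero.mp hf))
    (fun T hT h => hmax T hT fun f hf =>
      h f (Ideal.algebraMap_residueField_eq_zero.mpr hf))

theorem formallyEtale_residueField [CharZero K]
    (hind : ∀ f ∈ P, f ∈ supported K (S : Set (Fin n)) → f = 0)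
    (hmax : ∀ T : Finset (Fin n), S ⊆ T →
      (∀ f ∈ P, f ∈ supported K (T : Set (Fin n)) → f = 0) → T = S) :
    Algebra.FormallyEtale (supported K (S : Set (Fin n))) P.ResidueField := by
  have := isAlgebraic_residueField hind hmax
  have : FaithfulSMul (supported K (S : Set (Fin n))) P.ResidueField :=
    (faithfulSMul_iff_algebraMap_injective _ _).mpr (algebraMap_supported_injective hind)
  let F := FractionRing (supported K (S : Set (Fin n)))
  let : Algebra F P.ResidueField := FractionRing.liftAlgebra _ _
  have : IsScalarTower (supported K (S : Set (Fin n))) F P.ResidueField :=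
    FractionRing.isScalarTower_liftAlgebra _ _
  have : Algebra.IsAlgebraic F P.ResidueField :=
    (IsFractionRing.comap_isAlgebraic_iff (A := supported K (S : Set (Fin n)))).mp ‹_›
  have : CharZero F :=
    charZero_of_injective_algebraMap (FaithfulSMul.algebraMap_injective K F)
  have : Algebra.FormallyEtale (supported K (S : Set (Fin n))) F :=
    .of_isLocalization (nonZeroDivisors _)
  have : Algebra.FormallyEtale F P.ResidueField := .of_isSeparable _ _
  exact .comp _ F _

/-- Elements of the local ring are, up to a unit from `K[S]`, congruent to polynomials modulo
any power of the maximal ideal. -/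
theorem exists_smul_eq_algebraMap
    (hind : ∀ f ∈ P, f ∈ supported K (S : Set (Fin n)) → f = 0)
    (hmax : ∀ T : Finset (Fin n), S ⊆ T →
      (∀ f ∈ P, f ∈ supported K (T : Set (Fin n)) → f = 0) → T = S) (r : ℕ)
    (a : Localization.AtPrime P ⧸ IsLocalRing.maximalIdeal (Localization.AtPrime P) ^ r) :
    ∃ c ∈ supported K (S : Set (Fin n)), c ∉ P ∧ ∃ β : MvPolynomial (Fin n) K,
      algebraMap _ _ c * a = algebraMap (MvPolynomial (Fin n) K) _ β := by
  obtain ⟨a, rfl⟩ := Ideal.Quotient.mk_surjective a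
  obtain ⟨f, ⟨s, hs⟩, rfl⟩ := IsLocalization.exists_mk'_eq P.primeCompl a
  have halg := isAlgebraic_residueField hind hmax
  have h1 : IsAlgebraic (supported K (S : Set (Fin n))) (Ideal.Quotient.mk P s) :=
    (isAlgebraic_ringHom_iff_of_comp_eq (RingEquiv.refl (supported K (S : Set (Fin n))))
      (algebraMap (MvPolynomial (Fin n) K ⧸ P) P.ResidueField)
      P.injective_algebraMap_quotient_residueField (by ext; rfl)).mp (halg.isAlgebraic _)
  obtain ⟨c, hc0, y, hy⟩ := h1.exists_nonzero_dvd
    (mem_nonZeroDivisors_of_ne_zero fun h => hs (Ideal.Quotient.eq_zero_iff_mem.mp h))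
  obtain ⟨f', rfl⟩ := Ideal.Quotient.mk_surjective y
  have hcP : (c : MvPolynomial (Fin n) K) ∉ P := fun h => hc0 (Subtype.ext (hind c h c.2))
  have hp : (c : MvPolynomial (Fin n) K) - s * f' ∈ P := by
    rw [← Ideal.Quotient.eq_zero_iff_mem, map_sub, map_mul, ← hy, sub_eq_zero]
    rfl
  obtain ⟨e, he⟩ := sub_dvd_pow_sub_pow (c : MvPolynomial (Fin n) K) (c - s * f') r
  refine ⟨c ^ r, pow_mem c.2 r, fun h => hcP (Ideal.IsPrime.mem_of_pow_mem ‹_› r h),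
    f' * e * f, ?_⟩
  have hz : algebraMap (MvPolynomial (Fin n) K) (Localization.AtPrime P ⧸
      IsLocalRing.maximalIdeal (Localization.AtPrime P) ^ r) ((c - s * f') ^ r) = 0 := by
    rw [IsScalarTower.algebraMap_apply _ (Localization.AtPrime P), Ideal.Quotient.algebraMap_eq,
      Ideal.Quotient.eq_zero_iff_mem, map_pow]
    exact Ideal.pow_mem_pow
      ((IsLocalization.AtPrime.to_map_mem_maximal_iff _ P _).mpr hp) r
  have he' : (c : MvPolynomial (Fin n) K) ^ r = s * (f' * e) + (c - s * f') ^ r := by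
    linear_combination he
  rw [he', map_add, hz, add_zero]
  have hmk : ∀ p, algebraMap (MvPolynomial (Fin n) K) (Localization.AtPrime P ⧸
      IsLocalRing.maximalIdeal (Localization.AtPrime P) ^ r) p =
      Ideal.Quotient.mk _ (algebraMap _ (Localization.AtPrime P) p) := fun _ => rfl
  rw [hmk, hmk, ← map_mul]
  congr 1
  rw [map_mul, mul_right_comm, IsLocalization.mk'_spec'_mk, ← map_mul, mul_comm f]

end Residue

section CoefficientField

theorem map_quotientMk_pow_self {A : Type*} [CommRing A] (I : Ideal A) (r : ℕ) :
    I.map (Ideal.Quotient.mk (I ^ r)) ^ r = 0 := by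
  rw [← Ideal.map_pow, Ideal.map_quotient_self]
  rfl

theorem exists_algHom_sub_mem_of_formallySmooth {Λ R L : Type*} [CommRing Λ] [CommRing R]
    [CommRing L] [IsLocalRing L] [Algebra Λ R] [Algebra R L] (r : ℕ)
    [Algebra Λ (IsLocalRing.ResidueField L)]
    [Algebra Λ (L ⧸ IsLocalRing.maximalIdeal L ^ r)]
    [IsScalarTower Λ R (IsLocalRing.ResidueField L)]
    [IsScalarTower Λ R (L ⧸ IsLocalRing.maximalIdeal L ^ r)]
    [Algebra.FormallySmooth Λ (IsLocalRing.ResidueField L)] :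
    ∃ σ : IsLocalRing.ResidueField L →ₐ[Λ] L ⧸ IsLocalRing.maximalIdeal L ^ r,
      ∀ f : R, σ (algebraMap R (IsLocalRing.ResidueField L) f) - algebraMap R _ f ∈
        (IsLocalRing.maximalIdeal L).map (Ideal.Quotient.mk (IsLocalRing.maximalIdeal L ^ r)) := by
  let I := (IsLocalRing.maximalIdeal L).map (Ideal.Quotient.mk (IsLocalRing.maximalIdeal L ^ r))
  let g₀ : IsLocalRing.ResidueField L →+* (L ⧸ IsLocalRing.maximalIdeal L ^ r) ⧸ I :=
    Ideal.Quotient.lift (IsLocalRing.maximalIdeal L)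
      ((Ideal.Quotient.mk I).comp (Ideal.Quotient.mk _))
      fun _ ha => Ideal.Quotient.eq_zero_iff_mem.mpr (Ideal.mem_map_of_mem _ ha)
  have hg₀ : ∀ f : R, g₀ (algebraMap R _ f) = Ideal.Quotient.mk I (algebraMap R _ f) :=
    fun _ => rfl
  let g : IsLocalRing.ResidueField L →ₐ[Λ] (L ⧸ IsLocalRing.maximalIdeal L ^ r) ⧸ I :=
    { g₀ with
      commutes' := fun c => by
        have := hg₀ (algebraMap Λ R c)
        rwa [← IsScalarTower.algebraMap_apply, ← IsScalarTower.algebraMap_apply] at this }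
  obtain ⟨σ, hσ⟩ := Algebra.FormallySmooth.exists_lift I ⟨r, map_quotientMk_pow_self _ r⟩ g
  refine ⟨σ, fun f => ?_⟩
  rw [← Ideal.Quotient.mk_eq_mk_iff_sub_mem, ← hg₀]
  exact DFunLike.congr_fun hσ _

variable {K : Type*} [Field K] {n : ℕ} (P : Ideal (MvPolynomial (Fin n) K)) [P.IsPrime]

/-- The quotient of the local ring at `P` by the `r`-th power of its maximal ideal. -/
abbrev ArtinQuot (r : ℕ) : Type _ :=
  Localization.AtPrime P ⧸ IsLocalRing.maximalIdeal (Localization.AtPrime P) ^ r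

/-- The ideal of `ArtinQuot P r` generated by the maximal ideal of the local ring at `P`. -/
noncomputable abbrev artinIdeal (r : ℕ) : Ideal (ArtinQuot P r) :=
  (IsLocalRing.maximalIdeal (Localization.AtPrime P)).map (Ideal.Quotient.mk _)

theorem artinIdeal_pow (r : ℕ) : artinIdeal P r ^ r = 0 :=
  map_quotientMk_pow_self _ r

variable {P} {S : Finset (Fin n)}

theorem exists_coefficientField
    [Algebra.FormallyEtale (supported K (S : Set (Fin n))) P.ResidueField] (r : ℕ) :
    ∃ σ : P.ResidueField →ₐ[supported K (S : Set (Fin n))] ArtinQuot P r,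
      ∀ f : MvPolynomial (Fin n) K,
        σ (algebraMap _ P.ResidueField f) - algebraMap _ (ArtinQuot P r) f ∈ artinIdeal P r :=
  exists_algHom_sub_mem_of_formallySmooth r

end CoefficientField

section TaylorShift

variable {K : Type*} [Field K] {n : ℕ} (P : Ideal (MvPolynomial (Fin n) K)) [P.IsPrime]
  (S : Finset (Fin n))

open Classical in
/-- The substitution `X j ↦ x j + X j` for `j ∉ S` and `X j ↦ x j` for `j ∈ S`, where `x j` is
the class of `X j` in the residue field at `P`. -/
noncomputable def taylorShift :
    MvPolynomial (Fin n) K →+* MvPolynomial (Fin n) P.ResidueField :=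
  eval₂Hom (C.comp (algebraMap K P.ResidueField)) fun j =>
    C (algebraMap _ P.ResidueField (X j : MvPolynomial (Fin n) K)) + if j ∈ S then 0 else X j

open Classical in
theorem taylorShift_X (j : Fin n) : taylorShift P S (X j) =
    C (algebraMap _ P.ResidueField (X j : MvPolynomial (Fin n) K)) +
      if j ∈ S then 0 else X j := by
  simp [taylorShift]

theorem algebraMap_residueField_C (a : K) :
    algebraMap (MvPolynomial (Fin n) K) P.ResidueField (C a) = algebraMap K P.ResidueField a :=
  (IsScalarTower.algebraMap_apply K (MvPolynomial (Fin n) K) P.ResidueField a).symm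

theorem taylorShift_C (a : K) : taylorShift P S (C a) =
    C (algebraMap (MvPolynomial (Fin n) K) P.ResidueField (C a)) := by
  rw [algebraMap_residueField_C]
  simp [taylorShift]

theorem constantCoeff_taylorShift (f : MvPolynomial (Fin n) K) :
    constantCoeff (taylorShift P S f) = algebraMap _ P.ResidueField f := by
  have : (constantCoeff).comp (taylorShift P S) =
      algebraMap (MvPolynomial (Fin n) K) P.ResidueField := by
    refine MvPolynomial.ringHom_ext (fun a => ?_) fun j => ?_
    · rw [RingHom.comp_apply, taylorShift_C, constantCoeff_C]
    · rw [RingHom.comp_apply, taylorShift_X]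
      split_ifs <;> simp
  exact DFunLike.congr_fun this f

theorem mem_idealOfVars_of_constantCoeff {κ : Type*} [Field κ] {p : MvPolynomial (Fin n) κ}
    (hp : constantCoeff p = 0) : p ∈ idealOfVars (Fin n) κ := by
  rw [← pow_one (idealOfVars (Fin n) κ), mem_pow_idealOfVars_iff]
  intro x hx
  rw [Nat.one_le_iff_ne_zero]
  intro h
  rw [Finsupp.degree_eq_zero_iff] at h
  subst h
  exact (mem_support_iff.mp hx) hp

variable {P S}

theorem taylorShift_mem_idealOfVars {f : MvPolynomial (Fin n) K} (hf : f ∈ P) :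
    taylorShift P S f ∈ idealOfVars (Fin n) P.ResidueField :=
  mem_idealOfVars_of_constantCoeff <| by
    rw [constantCoeff_taylorShift, Ideal.algebraMap_residueField_eq_zero.mpr hf]

theorem taylorShift_mem_pow {f : MvPolynomial (Fin n) K} {N : ℕ} (hf : f ∈ P ^ N) :
    taylorShift P S f ∈ idealOfVars (Fin n) P.ResidueField ^ N := by
  have h : P ^ N ≤ (idealOfVars (Fin n) P.ResidueField ^ N).comap (taylorShift P S) :=
    le_trans (Ideal.pow_right_mono (fun _ => taylorShift_mem_idealOfVars) N)
      (Ideal.le_comap_pow _ N)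
  exact h hf

theorem taylorShift_of_mem_supported {f : MvPolynomial (Fin n) K}
    (hf : f ∈ supported K (S : Set (Fin n))) :
    taylorShift P S f = C (algebraMap _ P.ResidueField f) := by
  refine hom_congr_vars (f₁ := taylorShift P S)
    (f₂ := C.comp (algebraMap (MvPolynomial (Fin n) K) P.ResidueField))
    (RingHom.ext fun a => taylorShift_C P S a) (fun j hj _ => ?_) rfl
  have : j ∈ S := (mem_supported.mp hf) hj
  rw [taylorShift_X, if_pos this, add_zero]
  rfl

theorem coeff_eq_of_sub_mem {κ : Type*} [Field κ] {p q : MvPolynomial (Fin n) κ} {r : ℕ}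
    {α : Fin n →₀ ℕ} (h : p - q ∈ idealOfVars (Fin n) κ ^ r) (hα : α.degree < r) :
    coeff α p = coeff α q := by
  rw [mem_pow_idealOfVars_iff] at h
  by_contra hne
  refine (h α ?_).not_gt hα
  rwa [mem_support_iff, coeff_sub, sub_ne_zero]

open Classical in
theorem coeff_taylorShift [CharZero K] (α : Fin n →₀ ℕ) (hα : ∀ j ∈ S, α j = 0)
    (f : MvPolynomial (Fin n) K) :
    coeff α (taylorShift P S f) =
      algebraMap _ P.ResidueField (ipdP (fun i => α i) f) /
        ∏ i, ((α i).factorial : P.ResidueField) := by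
  have := charZero_residueField P
  set r := α.degree + 1 with hr
  have key := taylor_nilpotent (algebraMap (MvPolynomial (Fin n) K) P.ResidueField)
    ((Ideal.Quotient.mk (idealOfVars (Fin n) P.ResidueField ^ r)).comp C)
    ((Ideal.Quotient.mk (idealOfVars (Fin n) P.ResidueField ^ r)).comp (taylorShift P S))
    (fun j => Ideal.Quotient.mk _ (if j ∈ S then 0 else X j)) r
    (fun a => by simp only [RingHom.comp_apply, taylorShift_C])
    (fun j => by simp only [RingHom.comp_apply, taylorShift_X, map_add])
    (fun j => by
      rw [← map_pow, Ideal.Quotient.eq_zero_iff_mem]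
      refine Ideal.pow_mem_pow (mem_idealOfVars_of_constantCoeff ?_) r
      split_ifs <;> simp) f
  simp only [RingHom.comp_apply, ← map_pow, ← map_prod, ← map_mul, ← map_sum] at key
  rw [Ideal.Quotient.mk_eq_mk_iff_sub_mem] at key
  rw [coeff_eq_of_sub_mem key (by omega), coeff_sum]
  have hprod : ∀ β : Fin n → ℕ, (∏ i, (if i ∈ S then (0 : MvPolynomial (Fin n) P.ResidueField)
      else X i) ^ β i) = if ∀ j ∈ S, β j = 0 then
        monomial (Finsupp.equivFunOnFinite.symm β) 1 else 0 := by
    intro β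
    split_ifs with hβ
    · rw [monomial_eq, C_1, one_mul, Finsupp.prod_fintype _ _ (by simp)]
      refine Finset.prod_congr rfl fun i _ => ?_
      split_ifs with hi
      · simp [hβ i hi]
      · simp
    · push Not at hβ
      obtain ⟨j, hj, hβj⟩ := hβ
      exact Finset.prod_eq_zero (Finset.mem_univ j) (by simp [hj, hβj])
  rw [Finset.sum_eq_single (fun i => α i)]
  · rw [hprod, if_pos hα, mul_comm, coeff_C_mul]
    have : Finsupp.equivFunOnFinite.symm (fun i => α i) = α := by ext; simp
    rw [this, coeff_monomial, if_pos rfl, mul_one]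
  · intro β _ hβ
    rw [hprod, mul_comm, coeff_C_mul]
    split_ifs with h
    · rw [coeff_monomial, if_neg, mul_zero]
      rintro rfl
      exact hβ (by ext; simp)
    · simp
  · intro h
    refine absurd ?_ h
    simp only [Fintype.mem_piFinset, Finset.mem_range]
    intro i
    have := Finsupp.le_degree i α
    omega

theorem taylorShift_sub_mem [Algebra.FormallyEtale (supported K (S : Set (Fin n))) P.ResidueField]
    {r : ℕ} {σ : P.ResidueField →ₐ[supported K (S : Set (Fin n))] ArtinQuot P r}
    (hσ : ∀ f : MvPolynomial (Fin n) K,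
      σ (algebraMap _ P.ResidueField f) - algebraMap _ (ArtinQuot P r) f ∈ artinIdeal P r)
    {a : P.ResidueField} {β : MvPolynomial (Fin n) K}
    (h : σ a = algebraMap _ (ArtinQuot P r) β) :
    taylorShift P S β - C a ∈ idealOfVars (Fin n) P.ResidueField ^ r := by
  let J := idealOfVars (Fin n) P.ResidueField
  let Y := MvPolynomial (Fin n) P.ResidueField ⧸ J ^ r
  let I : Ideal Y := J.map (Ideal.Quotient.mk _)
  have hI : I ^ r = 0 := by
    rw [← Ideal.map_pow, Ideal.map_quotient_self]
    rfl
  let τ : MvPolynomial (Fin n) K →+* Y := (Ideal.Quotient.mk (J ^ r)).comp (taylorShift P S)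
  have hτ : ∀ f, τ f - Ideal.Quotient.mk _ (C (algebraMap _ P.ResidueField f)) ∈ I := by
    intro f
    rw [RingHom.comp_apply, ← map_sub]
    refine Ideal.mem_map_of_mem _ (mem_idealOfVars_of_constantCoeff ?_)
    rw [map_sub, constantCoeff_taylorShift, constantCoeff_C, sub_self]
  have hunit : ∀ s : P.primeCompl, IsUnit (τ s) := by
    intro s
    have h1 : IsUnit (Ideal.Quotient.mk (J ^ r) (C (algebraMap _ P.ResidueField s.1))) :=
      (IsUnit.mk0 _ fun h => s.2 (Ideal.algebraMap_residueField_eq_zero.mp h)).map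
        ((Ideal.Quotient.mk (J ^ r)).comp C)
    have h2 : IsNilpotent (τ s - Ideal.Quotient.mk _ (C (algebraMap _ P.ResidueField s.1))) :=
      ⟨r, by simpa [hI] using Ideal.pow_mem_pow (hτ s) r⟩
    have := h2.isUnit_add_left_of_commute h1 (Commute.all _ _)
    simpa using this
  let χ₀ : Localization.AtPrime P →+* Y := IsLocalization.lift hunit
  have hχ₀ : ∀ f, χ₀ (algebraMap _ _ f) = τ f := IsLocalization.lift_eq hunit
  have hχ₀I : IsLocalRing.maximalIdeal (Localization.AtPrime P) ≤ I.comap χ₀ := by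
    rw [← Localization.AtPrime.map_eq_maximalIdeal, Ideal.map_le_iff_le_comap]
    intro f hf
    rw [Ideal.mem_comap, Ideal.mem_comap, hχ₀]
    exact Ideal.mem_map_of_mem _ (taylorShift_mem_idealOfVars hf)
  let χ : ArtinQuot P r →+* Y := Ideal.Quotient.lift _ χ₀ fun a ha => by
    have := (Ideal.pow_right_mono hχ₀I r).trans (Ideal.le_comap_pow _ r) ha
    simpa [hI] using this
  have hχ : ∀ f, χ (algebraMap _ _ f) = τ f := hχ₀
  have hχI : artinIdeal P r ≤ I.comap χ := by
    rw [Ideal.map_le_iff_le_comap]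
    exact hχ₀I
  let : Algebra (supported K (S : Set (Fin n))) Y :=
    (τ.comp (supported K (S : Set (Fin n))).val.toRingHom).toAlgebra
  let g₁ : P.ResidueField →ₐ[supported K (S : Set (Fin n))] Y :=
    { χ.comp σ.toRingHom with
      commutes' := fun f => (congrArg χ (σ.commutes f)).trans (hχ f) }
  let g₂ : P.ResidueField →ₐ[supported K (S : Set (Fin n))] Y :=
    { (Ideal.Quotient.mk (J ^ r)).comp C with
      commutes' := fun f => congrArg (Ideal.Quotient.mk (J ^ r))
        (taylorShift_of_mem_supported f.2).symm }
  have hg : g₁ = g₂ := by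
    refine Algebra.FormallyUnramified.lift_unique_of_ringHom (Ideal.Quotient.mk I)
      ⟨r, by rw [Ideal.mk_ker, hI]⟩ g₁ g₂ (RingHom.ext fun z => ?_)
    have hR : ∀ f : MvPolynomial (Fin n) K,
        Ideal.Quotient.mk I (g₁ (algebraMap _ P.ResidueField f)) =
          Ideal.Quotient.mk I (g₂ (algebraMap _ P.ResidueField f)) := by
      intro f
      rw [Ideal.Quotient.mk_eq_mk_iff_sub_mem]
      have h1 : χ (σ (algebraMap _ P.ResidueField f)) - τ f ∈ I := by
        rw [← hχ, ← map_sub]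
        exact hχI (hσ f)
      have h2 := I.add_mem h1 (hτ f)
      rw [sub_add_sub_cancel] at h2
      exact h2
    obtain ⟨x, y, hy, rfl⟩ := exists_div_residueField P z
    have hy' : algebraMap _ P.ResidueField y ≠ 0 := fun h =>
      hy (Ideal.algebraMap_residueField_eq_zero.mp h)
    change Ideal.Quotient.mk I (g₁ _) = Ideal.Quotient.mk I (g₂ _)
    have hu : IsUnit (Ideal.Quotient.mk I (g₁ (algebraMap _ P.ResidueField y))) :=
      (IsUnit.mk0 _ hy').map ((Ideal.Quotient.mk I).comp g₁.toRingHom)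
    refine hu.mul_right_cancel ?_
    conv_rhs => rw [hR y]
    rw [← map_mul, ← map_mul, ← map_mul, ← map_mul, div_mul_cancel₀ _ hy', hR]
  have h1 : χ (σ a) = Ideal.Quotient.mk (J ^ r) (C a) := DFunLike.congr_fun hg a
  rw [h, hχ] at h1
  exact Ideal.Quotient.mk_eq_mk_iff_sub_mem _ _ |>.mp h1

end TaylorShift

section OpFunctional

variable {K : Type*} [Field K] {n k : ℕ} (P : Ideal (MvPolynomial (Fin n) K)) [P.IsPrime]

/-- The functional on vectors of polynomials over the residue field at `P` which corresponds to
the operator `B` through the Taylor expansion at the generic point of `P`. -/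
noncomputable def opFunctional (B : Fin k → MvPolynomial (Fin n) (MvPolynomial (Fin n) K)) :
    (Fin k → MvPolynomial (Fin n) P.ResidueField) →ₗ[P.ResidueField] P.ResidueField :=
  ∑ j, ∑ α ∈ (B j).support,
    (algebraMap _ P.ResidueField ((B j).coeff α) * ∏ i, ((α i).factorial : P.ResidueField)) •
      (lcoeff P.ResidueField α ∘ₗ LinearMap.proj j)

theorem opFunctional_apply (B : Fin k → MvPolynomial (Fin n) (MvPolynomial (Fin n) K))
    (v : Fin k → MvPolynomial (Fin n) P.ResidueField) :
    opFunctional P B v = ∑ j, ∑ α ∈ (B j).support,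
      (algebraMap _ P.ResidueField ((B j).coeff α) * ∏ i, ((α i).factorial : P.ResidueField)) *
        coeff α (v j) := by
  simp [opFunctional, LinearMap.sum_apply]

variable {P} {S : Finset (Fin n)}
  {B : Fin k → MvPolynomial (Fin n) (MvPolynomial (Fin n) K)}

theorem opFunctional_taylorShift [CharZero K]
    (hB : ∀ j, B j ∈ supported (MvPolynomial (Fin n) K) ((S : Set (Fin n))ᶜ))
    (m : Fin k → MvPolynomial (Fin n) K) :
    opFunctional P B (fun j => taylorShift P S (m j)) =
      algebraMap _ P.ResidueField (NoethAct B m) := by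
  have := charZero_residueField P
  rw [opFunctional_apply, NoethAct, map_sum]
  refine Finset.sum_congr rfl fun j _ => ?_
  rw [map_sum]
  refine Finset.sum_congr rfl fun α hα => ?_
  rw [coeff_taylorShift, map_mul, mul_assoc, mul_div_cancel₀]
  · exact Finset.prod_ne_zero_iff.mpr fun i _ => Nat.cast_ne_zero.mpr (Nat.factorial_ne_zero _)
  · intro i hi
    by_contra hne
    exact mem_supported.mp (hB j) ((mem_vars_iff_mem_support i).mpr
      ⟨α, hα, Finsupp.mem_support_iff.mpr hne⟩) hi

theorem opFunctional_eq_zero {r : ℕ} (hr : ∀ j, (B j).totalDegree < r)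
    {v : Fin k → MvPolynomial (Fin n) P.ResidueField}
    (hv : ∀ j, v j ∈ idealOfVars (Fin n) P.ResidueField ^ r) : opFunctional P B v = 0 := by
  rw [opFunctional_apply]
  refine Finset.sum_eq_zero fun j _ => Finset.sum_eq_zero fun α hα => ?_
  have h : coeff α (v j) = coeff α 0 :=
    coeff_eq_of_sub_mem (r := r) (by simpa using hv j) ((le_totalDegree hα).trans_lt (hr j))
  rw [h, coeff_zero, mul_zero]

theorem noethAct_mem_iff [CharZero K]
    (hB : ∀ j, B j ∈ supported (MvPolynomial (Fin n) K) ((S : Set (Fin n))ᶜ))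
    (m : Fin k → MvPolynomial (Fin n) K) :
    NoethAct B m ∈ P ↔ opFunctional P B (fun j => taylorShift P S (m j)) = 0 := by
  rw [opFunctional_taylorShift hB, Ideal.algebraMap_residueField_eq_zero]

theorem noethAct_mem_of_mem_pow [CharZero K]
    (hB : ∀ j, B j ∈ supported (MvPolynomial (Fin n) K) ((S : Set (Fin n))ᶜ))
    {r : ℕ} (hr : ∀ j, (B j).totalDegree < r) {g : MvPolynomial (Fin n) K} (hg : g ∈ P ^ r)
    (w : Fin k → MvPolynomial (Fin n) K) : NoethAct B (g • w) ∈ P := by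
  rw [noethAct_mem_iff hB]
  refine opFunctional_eq_zero hr fun j => ?_
  rw [Pi.smul_apply, smul_eq_mul, map_mul]
  exact Ideal.mul_mem_right _ _ (taylorShift_mem_pow hg)

theorem noethAct_mem_of_forall_mul [CharZero K]
    (hB : ∀ j, B j ∈ supported (MvPolynomial (Fin n) K) ((S : Set (Fin n))ᶜ))
    {h : MvPolynomial (Fin n) K} (hh : h ∉ P) {w : Fin k → MvPolynomial (Fin n) K}
    (hw : ∀ f : MvPolynomial (Fin n) K, NoethAct B ((f * h) • w) ∈ P) : NoethAct B w ∈ P := by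
  obtain ⟨N, hN⟩ : ∃ N, ∀ j, (B j).totalDegree < N :=
    ⟨Finset.univ.sup (fun j => (B j).totalDegree) + 1, fun j =>
      Nat.lt_succ_of_le (Finset.le_sup (f := fun j => (B j).totalDegree) (Finset.mem_univ j))⟩
  set c := algebraMap _ P.ResidueField h
  have hc : c ≠ 0 := fun h0 => hh (Ideal.algebraMap_residueField_eq_zero.mp h0)
  set u := taylorShift P S h
  set v : Fin k → MvPolynomial (Fin n) P.ResidueField := fun j => taylorShift P S (w j)
  have hzero : ∀ i, opFunctional P B (u ^ (i + 1) • v) = 0 := by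
    intro i
    have := hw (h ^ i)
    rw [noethAct_mem_iff hB] at this
    convert this using 2
    ext1 j
    simp [u, v, pow_succ]
  have hpow : ∀ N i, opFunctional P B (((C c - u) ^ N * u ^ i) • v) =
      c ^ N * opFunctional P B (u ^ i • v) := by
    intro N
    induction N with
    | zero => simp
    | succ N ih =>
      intro i
      have : ((C c - u) ^ (N + 1) * u ^ i) • v =
          c • ((C c - u) ^ N * u ^ i) • v - ((C c - u) ^ N * u ^ (i + 1)) • v := by
        ext1 j
        simp only [Pi.smul_apply, Pi.sub_apply, smul_eq_mul, smul_eq_C_mul]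
        ring
      rw [this, map_sub, map_smul, ih, ih, hzero, smul_eq_mul]
      ring
  have h0 : opFunctional P B (((C c - u) ^ N * u ^ 0) • v) = 0 := by
    refine opFunctional_eq_zero hN fun j => ?_
    rw [Pi.smul_apply, smul_eq_mul, pow_zero, mul_one]
    refine Ideal.mul_mem_right _ _ (Ideal.pow_mem_pow (mem_idealOfVars_of_constantCoeff ?_) _)
    rw [map_sub, constantCoeff_C, constantCoeff_taylorShift, sub_self]
  rw [hpow, pow_zero, one_smul] at h0
  exact (noethAct_mem_iff hB w).mpr ((mul_eq_zero.mp h0).resolve_left (pow_ne_zero _ hc))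

end OpFunctional

section Length

theorem isSimpleModule_of_coefficientField {κ A M : Type*} [Field κ] [CommRing A] [Algebra κ A]
    [AddCommGroup M] [Module A M] [Module κ M] [IsScalarTower κ A M] (I : Ideal A) {r : ℕ}
    (hI : I ^ r = 0) (hA : ∀ a : A, ∃ c : κ, a - algebraMap κ A c ∈ I) [IsSimpleModule A M] :
    IsSimpleModule κ M := by
  have hbot : I • (⊤ : Submodule A M) = ⊥ := by
    refine (eq_bot_or_eq_top (I • (⊤ : Submodule A M))).resolve_right fun h => ?_
    have hp : ∀ i, I ^ i • (⊤ : Submodule A M) = ⊤ := by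
      intro i
      induction i with
      | zero => simp
      | succ i ih => rw [pow_succ, Submodule.mul_smul, h, ih]
    have h1 := hp r
    rw [hI, Submodule.zero_eq_bot, Submodule.bot_smul] at h1
    exact bot_ne_top h1
  have hzero : ∀ a ∈ I, ∀ x : M, a • x = 0 := fun a ha x => by
    rw [← Submodule.mem_bot A, ← hbot]
    exact Submodule.smul_mem_smul ha trivial
  have := IsSimpleModule.nontrivial A M
  have : Nontrivial (Submodule κ M) := (Submodule.nontrivial_iff κ).mpr ‹_›
  rw [isSimpleModule_iff]
  refine ⟨fun N => ?_⟩
  let N' : Submodule A M :=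
    { N with
      smul_mem' := fun a x hx => by
        obtain ⟨c, hc⟩ := hA a
        have h := hzero _ hc x
        rw [sub_smul, sub_eq_zero, algebraMap_smul] at h
        rw [h]
        exact N.smul_mem c hx }
  rcases eq_bot_or_eq_top N' with h | h
  · left
    rw [eq_bot_iff]
    intro x hx
    have : x ∈ N' := hx
    rwa [h] at this
  · right
    rw [eq_top_iff]
    intro x _
    have : x ∈ N' := h ▸ trivial
    exact this

theorem length_eq_of_coefficientField {κ A M : Type*} [Field κ] [CommRing A] [Algebra κ A]
    [AddCommGroup M] [Module A M] [Module κ M] [IsScalarTower κ A M] (I : Ideal A) {r : ℕ}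
    (hI : I ^ r = 0) (hA : ∀ a : A, ∃ c : κ, a - algebraMap κ A c ∈ I) (hM : IsFiniteLength A M) :
    Module.length κ M = Module.length A M := by
  revert hA hI
  revert ‹Module κ M›
  induction hM with
  | of_subsingleton => intros; rw [Module.length_eq_zero, Module.length_eq_zero]
  | @of_simple_quotient M _ _ N _ _ ih =>
    intro _ _ hI hA
    have hs : IsSimpleModule κ (M ⧸ N) := isSimpleModule_of_coefficientField I hI hA
    rw [Module.length_eq_add_of_exact N.subtype N.mkQ N.injective_subtype N.mkQ_surjective
      (LinearMap.exact_subtype_mkQ N), ← ih hI hA, Module.length_eq_one A (M ⧸ N),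
      Module.length_eq_add_of_exact (N.subtype.restrictScalars κ) (N.mkQ.restrictScalars κ)
      N.injective_subtype N.mkQ_surjective (LinearMap.exact_subtype_mkQ N),
      Module.length_eq_one κ (M ⧸ N)]

end Length

section LocalTorsion

variable {L N : Type*} [CommRing L] [AddCommGroup N] [Module L N] (I : Ideal L)

/-- The submodule of elements annihilated by some power of `I`. -/
def powTorsion (N : Type*) [AddCommGroup N] [Module L N] : Submodule L N :=
  ⨆ r : ℕ, Submodule.torsionBySet L N ((I ^ r : Ideal L) : Set L)

theorem monotone_torsionBySet_pow :
    Monotone fun r : ℕ => Submodule.torsionBySet L N ((I ^ r : Ideal L) : Set L) :=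
  fun _ _ h => Submodule.torsionBySet_le_torsionBySet_of_subset (Ideal.pow_le_pow_right h)

variable {I}

theorem mem_powTorsion {x : N} :
    x ∈ powTorsion I N ↔ ∃ r : ℕ, ∀ a ∈ I ^ r, a • x = 0 := by
  rw [powTorsion, Submodule.mem_iSup_of_directed _ (monotone_torsionBySet_pow I).directed_le]
  simp [Submodule.mem_torsionBySet_iff]

theorem exists_forall_powTorsion [IsNoetherian L N] :
    ∃ r : ℕ, ∀ a ∈ I ^ r, ∀ x ∈ powTorsion I N, a • x = 0 := by
  obtain ⟨r, hr⟩ := monotone_stabilizes_iff_noetherian.mpr ‹IsNoetherian L N›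
    ⟨_, monotone_torsionBySet_pow I⟩
  refine ⟨r, fun a ha x hx => ?_⟩
  obtain ⟨r', hx⟩ := mem_powTorsion.mp hx
  have h1 : x ∈ Submodule.torsionBySet L N ((I ^ max r r' : Ideal L) : Set L) :=
    (Submodule.mem_torsionBySet_iff _ _).mpr fun b =>
      hx b.1 (Ideal.pow_le_pow_right (le_max_right r r') b.2)
  have h2 := hr (max r r') (le_max_left r r')
  change Submodule.torsionBySet L N ((I ^ r : Ideal L) : Set L) =
    Submodule.torsionBySet L N ((I ^ max r r' : Ideal L) : Set L) at h2
  rw [← h2] at h1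
  exact (Submodule.mem_torsionBySet_iff _ _).mp h1 ⟨a, ha⟩

theorem exists_pow_smul_top_inf_powTorsion [IsNoetherianRing L] [Module.Finite L N] :
    ∃ r₀ : ℕ, ∀ r, r₀ ≤ r → (I ^ r • (⊤ : Submodule L N)) ⊓ powTorsion I N = ⊥ ∧
      ∀ a ∈ I ^ r, ∀ x ∈ powTorsion I N, a • x = 0 := by
  obtain ⟨r₁, h₁⟩ := exists_forall_powTorsion (I := I) (N := N)
  obtain ⟨k, hk⟩ := Ideal.exists_pow_inf_eq_pow_smul I (powTorsion I N)
  refine ⟨k + r₁, fun r hr => ⟨?_, fun a ha => h₁ a (Ideal.pow_le_pow_right (by omega) ha)⟩⟩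
  rw [hk r (by omega), eq_bot_iff, Submodule.smul_le]
  intro a ha x hx
  rw [Submodule.mem_bot]
  exact h₁ a (Ideal.pow_le_pow_right (by omega) ha) x hx.2

end LocalTorsion

section QuotTorsion

variable {L : Type*} [CommRing L] (I : Ideal L) (r : ℕ) (N : Type*) [AddCommGroup N] [Module L N]

/-- The image of `powTorsion I N` in `N ⧸ I ^ r N`. -/
def quotTorsion : Submodule (L ⧸ I ^ r) (N ⧸ I ^ r • (⊤ : Submodule L N)) where
  carrier := (I ^ r • (⊤ : Submodule L N)).mkQ '' powTorsion I N
  add_mem' := by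
    rintro _ _ ⟨x, hx, rfl⟩ ⟨y, hy, rfl⟩
    exact ⟨x + y, add_mem hx hy, map_add _ _ _⟩
  zero_mem' := ⟨0, zero_mem _, map_zero _⟩
  smul_mem' := by
    rintro a _ ⟨x, hx, rfl⟩
    obtain ⟨a, rfl⟩ := Ideal.Quotient.mk_surjective a
    exact ⟨a • x, Submodule.smul_mem _ a hx, rfl⟩

variable {I r N}

theorem length_quotTorsion (h : (I ^ r • (⊤ : Submodule L N)) ⊓ powTorsion I N = ⊥) :
    Module.length (L ⧸ I ^ r) (quotTorsion I r N) = Module.length L (powTorsion I N) := by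
  rw [← Module.length_eq_of_surjective (S := L) (R := L ⧸ I ^ r) Ideal.Quotient.mk_surjective]
  let f : powTorsion I N →ₗ[L] quotTorsion I r N :=
    { toFun := fun x => ⟨(I ^ r • (⊤ : Submodule L N)).mkQ x, x, x.2, rfl⟩
      map_add' := fun _ _ => rfl
      map_smul' := fun _ _ => rfl }
  refine (LinearEquiv.ofBijective f ⟨?_, ?_⟩).length_eq.symm
  · rw [← LinearMap.ker_eq_bot, LinearMap.ker_eq_bot']
    intro x hx
    have h1 : (I ^ r • (⊤ : Submodule L N)).mkQ x = 0 := congrArg Subtype.val hx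
    rw [Submodule.mkQ_apply, Submodule.Quotient.mk_eq_zero] at h1
    have h2 : (x : N) ∈ (I ^ r • (⊤ : Submodule L N)) ⊓ powTorsion I N := ⟨h1, x.2⟩
    rw [h] at h2
    exact Subtype.ext h2
  · rintro ⟨_, x, hx, rfl⟩
    exact ⟨⟨x, hx⟩, rfl⟩

theorem isArtinianRing_quotient_maximalIdeal_pow [IsNoetherianRing L] [IsLocalRing L] (r : ℕ) :
    IsArtinianRing (L ⧸ IsLocalRing.maximalIdeal L ^ r) := by
  rcases eq_or_ne r 0 with rfl | hr
  · have : Subsingleton (L ⧸ IsLocalRing.maximalIdeal L ^ 0) :=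
      Ideal.Quotient.subsingleton_iff.mpr (by simp)
    infer_instance
  have hne : IsLocalRing.maximalIdeal L ^ r ≠ ⊤ := fun h =>
    (IsLocalRing.maximalIdeal.isMaximal L).ne_top (top_le_iff.mp (h ▸ Ideal.pow_le_self hr))
  have : Nontrivial (L ⧸ IsLocalRing.maximalIdeal L ^ r) := Ideal.Quotient.nontrivial_iff.mpr hne
  have : IsLocalRing (L ⧸ IsLocalRing.maximalIdeal L ^ r) :=
    IsLocalRing.of_surjective' _ Ideal.Quotient.mk_surjective
  rw [isArtinianRing_iff_isNilpotent_maximalIdeal]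
  refine ⟨r, le_bot_iff.mp ?_⟩
  rw [← Ideal.zero_eq_bot, ← map_quotientMk_pow_self (IsLocalRing.maximalIdeal L) r]
  refine Ideal.pow_right_mono (fun a ha => ?_) r
  obtain ⟨a, rfl⟩ := Ideal.Quotient.mk_surjective a
  refine Ideal.mem_map_of_mem _ ?_
  rw [IsLocalRing.mem_maximalIdeal, mem_nonunits_iff] at ha ⊢
  exact fun h => ha (h.map _)

theorem finrank_quotTorsion {κ : Type*} [Field κ] [IsNoetherianRing L] [IsLocalRing L]
    [Module.Finite L N] [Algebra κ (L ⧸ IsLocalRing.maximalIdeal L ^ r)]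
    [Module κ (N ⧸ IsLocalRing.maximalIdeal L ^ r • (⊤ : Submodule L N))]
    [IsScalarTower κ (L ⧸ IsLocalRing.maximalIdeal L ^ r)
      (N ⧸ IsLocalRing.maximalIdeal L ^ r • (⊤ : Submodule L N))]
    (hA : ∀ a : L ⧸ IsLocalRing.maximalIdeal L ^ r, ∃ c : κ, a - algebraMap κ _ c ∈
      (IsLocalRing.maximalIdeal L).map (Ideal.Quotient.mk (IsLocalRing.maximalIdeal L ^ r)))
    (h : (IsLocalRing.maximalIdeal L ^ r • (⊤ : Submodule L N)) ⊓
      powTorsion (IsLocalRing.maximalIdeal L) N = ⊥) :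
    Module.Finite κ (quotTorsion (IsLocalRing.maximalIdeal L) r N) ∧
      Module.length L (powTorsion (IsLocalRing.maximalIdeal L) N) =
        Module.finrank κ (quotTorsion (IsLocalRing.maximalIdeal L) r N) := by
  have := isArtinianRing_quotient_maximalIdeal_pow (L := L) r
  have : Module.Finite (L ⧸ IsLocalRing.maximalIdeal L ^ r)
      (N ⧸ IsLocalRing.maximalIdeal L ^ r • (⊤ : Submodule L N)) :=
    Module.Finite.of_restrictScalars_finite L _ _
  have hfl : IsFiniteLength (L ⧸ IsLocalRing.maximalIdeal L ^ r)
      (quotTorsion (IsLocalRing.maximalIdeal L) r N) :=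
    isFiniteLength_iff_isNoetherian_isArtinian.mpr ⟨inferInstance, inferInstance⟩
  have hlen := length_eq_of_coefficientField (κ := κ) _
    (map_quotientMk_pow_self (IsLocalRing.maximalIdeal L) r) hA hfl
  have hfin : Module.Finite κ (quotTorsion (IsLocalRing.maximalIdeal L) r N) := by
    have : IsFiniteLength κ (quotTorsion (IsLocalRing.maximalIdeal L) r N) := by
      rw [← Module.length_ne_top_iff, hlen, Module.length_ne_top_iff]
      exact hfl
    have := (isFiniteLength_iff_isNoetherian_isArtinian.mp this).1
    infer_instance
  refine ⟨hfin, ?_⟩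
  rw [← length_quotTorsion h, ← hlen, Module.length_eq_finrank]

end QuotTorsion

section LocalizedTorsion

variable {R E : Type*} [CommRing R] [AddCommGroup E] [Module R E] (P : Ideal R) [P.IsPrime]

theorem arithLength_eq :
    arithLength R E P ‹_› = Module.length (Localization.AtPrime P)
      (powTorsion (IsLocalRing.maximalIdeal (Localization.AtPrime P))
        (LocalizedModule P.primeCompl E)) := by
  rw [Module.coe_length, powTorsion, ← Localization.AtPrime.map_eq_maximalIdeal]
  rfl

variable {P}

theorem mkLinearMap_eq_zero_iff {e : E} :
    LocalizedModule.mkLinearMap P.primeCompl E e = 0 ↔ ∃ t ∉ P, t • e = 0 := by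
  rw [← LinearMap.mem_ker, LocalizedModule.mem_ker_mkLinearMap_iff]
  rfl

theorem exists_smul_eq_mkLinearMap (x : LocalizedModule P.primeCompl E) :
    ∃ s ∉ P, ∃ e : E, algebraMap R (Localization.AtPrime P) s • x =
      LocalizedModule.mkLinearMap P.primeCompl E e := by
  obtain ⟨⟨e, s⟩, hs⟩ := IsLocalizedModule.surj P.primeCompl
    (LocalizedModule.mkLinearMap P.primeCompl E) x
  refine ⟨s, s.2, e, ?_⟩
  rw [algebraMap_smul]
  exact hs

theorem mkLinearMap_mem_powTorsion_iff [IsNoetherianRing R] {e : E} :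
    LocalizedModule.mkLinearMap P.primeCompl E e ∈
        powTorsion (IsLocalRing.maximalIdeal (Localization.AtPrime P))
          (LocalizedModule P.primeCompl E) ↔
      ∃ r : ℕ, ∃ t ∉ P, ∀ f ∈ P ^ r, t • f • e = 0 := by
  rw [mem_powTorsion]
  refine exists_congr fun r => ⟨fun h => ?_, ?_⟩
  · have h1 : ∀ f ∈ P ^ r, ∃ t ∉ P, t • f • e = 0 := by
      intro f hf
      rw [← mkLinearMap_eq_zero_iff, map_smul,
        ← algebraMap_smul (Localization.AtPrime P) f]
      refine h _ ?_
      rw [← Localization.AtPrime.map_eq_maximalIdeal, ← Ideal.map_pow]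
      exact Ideal.mem_map_of_mem _ hf
    obtain ⟨G, hG⟩ := (isNoetherianRing_iff_ideal_fg R).mp ‹_› (P ^ r)
    choose! t ht hte using h1
    have hGP : ∀ g ∈ G, g ∈ P ^ r := fun g hg => hG ▸ Submodule.subset_span hg
    refine ⟨∏ g ∈ G, t g, fun hmem => ?_, fun f hf => ?_⟩
    · obtain ⟨g, hg, hgt⟩ := (Ideal.IsPrime.prod_mem_iff (p := P)).mp hmem
      exact ht g (hGP g hg) hgt
    · rw [← hG] at hf
      induction hf using Submodule.span_induction with
      | mem g hg =>
        obtain ⟨d, hd⟩ := Finset.dvd_prod_of_mem t hg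
        rw [hd, mul_comm, mul_smul, hte g (hGP g hg), smul_zero]
      | zero => simp
      | add x y _ _ hx hy => rw [add_smul, smul_add, hx, hy, add_zero]
      | smul a x _ hx => rw [smul_eq_mul, mul_smul, smul_comm, hx, smul_zero]
  · rintro ⟨t, ht, h⟩ a ha
    rw [← Localization.AtPrime.map_eq_maximalIdeal, ← Ideal.map_pow] at ha
    refine Submodule.span_induction (p := fun a _ => a •
      LocalizedModule.mkLinearMap P.primeCompl E e = 0) ?_ ?_ ?_ ?_ ha
    · rintro _ ⟨f, hf, rfl⟩
      rw [algebraMap_smul, ← map_smul, mkLinearMap_eq_zero_iff]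
      exact ⟨t, ht, h f hf⟩
    · exact zero_smul _ _
    · intro x y _ _ hx hy
      rw [add_smul, hx, hy, add_zero]
    · intro a x _ hx
      rw [smul_eq_mul, mul_smul, hx, smul_zero]

end LocalizedTorsion

theorem exists_algebraMap_eq_sum {K κ A : Type*} [Field K] [Field κ] [CharZero κ] [CommRing A]
    {n : ℕ} [Algebra (MvPolynomial (Fin n) K) κ] [Algebra (MvPolynomial (Fin n) K) A]
    {S : Finset (Fin n)} (σ : κ →+* A) (r : ℕ)
    (hC : ∀ a : K, σ (algebraMap (MvPolynomial (Fin n) K) κ (C a)) =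
      algebraMap (MvPolynomial (Fin n) K) A (C a))
    (hS : ∀ i ∈ S, σ (algebraMap (MvPolynomial (Fin n) K) κ (X i)) =
      algebraMap (MvPolynomial (Fin n) K) A (X i))
    (hr : ∀ i, (σ (algebraMap (MvPolynomial (Fin n) K) κ (X i)) -
      algebraMap (MvPolynomial (Fin n) K) A (X i)) ^ r = 0) :
    ∃ h : (Fin n → ℕ) → A, (∀ α, (∃ i ∈ S, α i ≠ 0) → h α = 0) ∧
      ∀ f : MvPolynomial (Fin n) K, algebraMap _ A f =
        ∑ α ∈ Fintype.piFinset (fun _ => Finset.range r),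
          σ (algebraMap _ κ (ipdP α f)) * h α := by
  refine ⟨fun α => σ ((∏ i, ((α i).factorial : κ))⁻¹) *
    ∏ i, (algebraMap (MvPolynomial (Fin n) K) A (X i) -
      σ (algebraMap (MvPolynomial (Fin n) K) κ (X i))) ^ α i, ?_, fun f => ?_⟩
  · rintro α ⟨i, hi, hα⟩
    refine mul_eq_zero_of_right _ (Finset.prod_eq_zero (Finset.mem_univ i) ?_)
    rw [hS i hi, sub_self, zero_pow hα]
  · rw [taylor_nilpotent (algebraMap (MvPolynomial (Fin n) K) κ) σ
      (algebraMap (MvPolynomial (Fin n) K) A)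
      (fun i => algebraMap (MvPolynomial (Fin n) K) A (X i) -
        σ (algebraMap (MvPolynomial (Fin n) K) κ (X i))) r (fun a => (hC a).symm) ?_ ?_ f]
    · refine Finset.sum_congr rfl fun α _ => ?_
      rw [div_eq_mul_inv, map_mul]
      ring
    · intro i
      ring
    · intro i
      rw [← neg_sub, neg_pow, hr, mul_zero]

section CoefficientField

variable {K : Type*} [Field K] {n : ℕ} {P : Ideal (MvPolynomial (Fin n) K)} [P.IsPrime]
  {S : Finset (Fin n)} {r : ℕ}
  {σ : P.ResidueField →ₐ[supported K (S : Set (Fin n))] ArtinQuot P r}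

theorem exists_sub_coefficientField_mem
    (hσ : ∀ f : MvPolynomial (Fin n) K,
      σ (algebraMap _ P.ResidueField f) - algebraMap _ (ArtinQuot P r) f ∈ artinIdeal P r)
    (a : ArtinQuot P r) : ∃ c, a - σ c ∈ artinIdeal P r := by
  obtain ⟨l, rfl⟩ := Ideal.Quotient.mk_surjective a
  obtain ⟨f, s, rfl⟩ := IsLocalization.exists_mk'_eq P.primeCompl l
  set a := Ideal.Quotient.mk (IsLocalRing.maximalIdeal (Localization.AtPrime P) ^ r)
    (IsLocalization.mk' (Localization.AtPrime P) f s) with ha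
  have hs : algebraMap _ P.ResidueField s.1 ≠ 0 := fun h =>
    s.2 (Ideal.algebraMap_residueField_eq_zero.mp h)
  have has : a * algebraMap _ (ArtinQuot P r) s.1 = algebraMap _ (ArtinQuot P r) f := by
    have := IsLocalization.mk'_spec (Localization.AtPrime P) f s
    exact congrArg (Ideal.Quotient.mk (IsLocalRing.maximalIdeal (Localization.AtPrime P) ^ r)) this
  refine ⟨algebraMap _ P.ResidueField f / algebraMap _ P.ResidueField s.1, ?_⟩
  have hu : IsUnit (σ (algebraMap _ P.ResidueField s.1)) := (IsUnit.mk0 _ hs).map σ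
  rw [← Ideal.unit_mul_mem_iff_mem _ hu]
  have h1 : σ (algebraMap _ P.ResidueField s.1) *
      (a - σ (algebraMap _ P.ResidueField f / algebraMap _ P.ResidueField s.1)) =
      a * (σ (algebraMap _ P.ResidueField s.1) - algebraMap _ (ArtinQuot P r) s.1) -
        (σ (algebraMap _ P.ResidueField f) - algebraMap _ (ArtinQuot P r) f) := by
    rw [mul_sub, ← map_mul, mul_div_cancel₀ _ hs, mul_sub, has]
    ring
  rw [h1]
  exact sub_mem (Ideal.mul_mem_left _ _ (hσ s)) (hσ f)

theorem coefficientField_of_mem_supported {f : MvPolynomial (Fin n) K}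
    (hf : f ∈ supported K (S : Set (Fin n))) :
    σ (algebraMap _ P.ResidueField f) = algebraMap _ (ArtinQuot P r) f :=
  σ.commutes ⟨f, hf⟩

theorem algebraMap_artinQuot_eq_sum [CharZero K]
    (hσ : ∀ f : MvPolynomial (Fin n) K,
      σ (algebraMap _ P.ResidueField f) - algebraMap _ (ArtinQuot P r) f ∈ artinIdeal P r) :
    ∃ h : (Fin n → ℕ) → ArtinQuot P r, (∀ α, (∃ i ∈ S, α i ≠ 0) → h α = 0) ∧
      ∀ f : MvPolynomial (Fin n) K, algebraMap _ (ArtinQuot P r) f =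
        ∑ α ∈ Fintype.piFinset (fun _ => Finset.range r),
          σ (algebraMap _ P.ResidueField (ipdP α f)) * h α := by
  have := charZero_residueField P
  refine exists_algebraMap_eq_sum (S := S) (κ := P.ResidueField) (A := ArtinQuot P r) σ.toRingHom r
    (fun a => coefficientField_of_mem_supported (Subalgebra.algebraMap_mem _ a))
    (fun i hi => coefficientField_of_mem_supported (X_mem_supported.mpr hi)) fun i => ?_
  have := Ideal.pow_mem_pow (hσ (X i)) r
  rwa [artinIdeal_pow] at this

theorem exists_coefficientField_mul_eq [CharZero K]
    (hind : ∀ f ∈ P, f ∈ supported K (S : Set (Fin n)) → f = 0)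
    (hmax : ∀ T : Finset (Fin n), S ⊆ T →
      (∀ f ∈ P, f ∈ supported K (T : Set (Fin n)) → f = 0) → T = S)
    {ι : Type*} [Fintype ι] (a : ι → ArtinQuot P r) :
    ∃ c ∈ supported K (S : Set (Fin n)), c ∉ P ∧ ∃ β : ι → MvPolynomial (Fin n) K,
      ∀ i, σ (algebraMap _ P.ResidueField c) * a i = algebraMap _ _ (β i) := by
  choose c hcS hcP β hβ using fun i => exists_smul_eq_algebraMap hind hmax r (a i)
  have hS : ∏ i, c i ∈ supported K (S : Set (Fin n)) := prod_mem fun i _ => hcS i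
  have hdvd : ∀ i, ∃ d, ∏ i, c i = c i * d := fun i =>
    Finset.dvd_prod_of_mem c (Finset.mem_univ i)
  choose d hd using hdvd
  refine ⟨∏ i, c i, hS, ?_, fun i => d i * β i, fun i => ?_⟩
  · rw [Ideal.IsPrime.prod_mem_iff]
    rintro ⟨i, _, hi⟩
    exact hcP i hi
  · rw [coefficientField_of_mem_supported hS, hd i, mul_comm (c i), map_mul, mul_assoc, hβ,
      map_mul]

end CoefficientField

theorem exists_vectorSpace_model.{u, v, w} {L : Type u} {κ : Type v} [CommRing L]
    [IsNoetherianRing L] [IsLocalRing L] [Field κ] {N : Type w} [AddCommGroup N] [Module L N]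
    [Module.Finite L N] {r : ℕ} (σ : κ →+* L ⧸ IsLocalRing.maximalIdeal L ^ r)
    (hσ : ∀ a, ∃ c, a - σ c ∈
      (IsLocalRing.maximalIdeal L).map (Ideal.Quotient.mk (IsLocalRing.maximalIdeal L ^ r)))
    (h : (IsLocalRing.maximalIdeal L ^ r • (⊤ : Submodule L N)) ⊓
      powTorsion (IsLocalRing.maximalIdeal L) N = ⊥) :
    ∃ (V : Type w) (_ : AddCommGroup V) (_ : Module (L ⧸ IsLocalRing.maximalIdeal L ^ r) V)
      (_ : Module κ V) (p : N →+ V) (W : Submodule κ V),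
      (∀ (c : κ) (v : V), c • v = σ c • v) ∧
      (∀ (l : L) (x : N), p (l • x) =
        Ideal.Quotient.mk (IsLocalRing.maximalIdeal L ^ r) l • p x) ∧
      Module.Finite κ W ∧
      Module.length L (powTorsion (IsLocalRing.maximalIdeal L) N) = Module.finrank κ W ∧
      (∀ x ∈ powTorsion (IsLocalRing.maximalIdeal L) N, p x ∈ W) ∧
      (∀ v ∈ W, ∃ x ∈ powTorsion (IsLocalRing.maximalIdeal L) N, p x = v) ∧
      ∀ x ∈ powTorsion (IsLocalRing.maximalIdeal L) N, p x = 0 → x = 0 := by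
  let _ : Algebra κ (L ⧸ IsLocalRing.maximalIdeal L ^ r) := σ.toAlgebra
  let _ : Module κ (N ⧸ IsLocalRing.maximalIdeal L ^ r • (⊤ : Submodule L N)) :=
    Module.compHom _ σ
  have : IsScalarTower κ (L ⧸ IsLocalRing.maximalIdeal L ^ r)
      (N ⧸ IsLocalRing.maximalIdeal L ^ r • (⊤ : Submodule L N)) :=
    ⟨fun c a v => mul_smul (σ c) a v⟩
  obtain ⟨hfin, hlen⟩ := finrank_quotTorsion (κ := κ) hσ h
  refine ⟨N ⧸ IsLocalRing.maximalIdeal L ^ r • (⊤ : Submodule L N), inferInstance, inferInstance,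
    inferInstance, (Submodule.mkQ _).toAddMonoidHom,
    (quotTorsion (IsLocalRing.maximalIdeal L) r N).restrictScalars κ, fun _ _ => rfl,
    fun _ _ => rfl, hfin, hlen, fun x hx => ⟨x, hx, rfl⟩, fun v hv => hv, fun x hx hx0 => ?_⟩
  have hmem : x ∈ (IsLocalRing.maximalIdeal L ^ r • (⊤ : Submodule L N)) ⊓
      powTorsion (IsLocalRing.maximalIdeal L) N :=
    ⟨(Submodule.Quotient.mk_eq_zero _).mp hx0, hx⟩
  rwa [h, Submodule.mem_bot] at hmem

section LocalModel

universe u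

variable {K : Type u} [Field K] {n k : ℕ}

/-- The class of `w` in the localization at `P` of the quotient by `M` is annihilated by some power
of `P`. -/
def IsPowTors (M : Submodule (MvPolynomial (Fin n) K) (Fin k → MvPolynomial (Fin n) K))
    (P : Ideal (MvPolynomial (Fin n) K)) (w : Fin k → MvPolynomial (Fin n) K) : Prop :=
  ∃ r : ℕ, ∃ t ∉ P, ∀ f ∈ P ^ r, (t * f) • w ∈ M

theorem isPowTors_iff {M : Submodule (MvPolynomial (Fin n) K) (Fin k → MvPolynomial (Fin n) K)}
    {P : Ideal (MvPolynomial (Fin n) K)} [P.IsPrime] {w : Fin k → MvPolynomial (Fin n) K} :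
    IsPowTors M P w ↔ LocalizedModule.mkLinearMap P.primeCompl _ (M.mkQ w) ∈
      powTorsion (IsLocalRing.maximalIdeal (Localization.AtPrime P))
        (LocalizedModule P.primeCompl ((Fin k → MvPolynomial (Fin n) K) ⧸ M)) := by
  rw [mkLinearMap_mem_powTorsion_iff]
  refine exists_congr fun r => exists_congr fun t => and_congr_right fun _ =>
    forall₂_congr fun f _ => ?_
  rw [← map_smul, ← map_smul, smul_smul, Submodule.mkQ_apply, Submodule.Quotient.mk_eq_zero]

theorem IsPowTors.smul {M : Submodule (MvPolynomial (Fin n) K) (Fin k → MvPolynomial (Fin n) K)}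
    {P : Ideal (MvPolynomial (Fin n) K)} {w : Fin k → MvPolynomial (Fin n) K}
    (h : IsPowTors M P w) (g : MvPolynomial (Fin n) K) : IsPowTors M P (g • w) := by
  obtain ⟨r, t, ht, h⟩ := h
  refine ⟨r, t, ht, fun f hf => ?_⟩
  rw [smul_comm]
  exact M.smul_mem _ (h f hf)

/-- A finite-order model of the localization of `(Fin k → R) ⧸ M` at `P`, viewed as a vector space
over a coefficient field. -/
structure LocalModel (M : Submodule (MvPolynomial (Fin n) K) (Fin k → MvPolynomial (Fin n) K))
    (P : Ideal (MvPolynomial (Fin n) K)) [P.IsPrime] (S : Finset (Fin n)) (r : ℕ) where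
  /-- the underlying vector space -/
  V : Type u
  [addCommGroup : AddCommGroup V]
  [module : Module P.ResidueField V]
  /-- the canonical map -/
  q : (Fin k → MvPolynomial (Fin n) K) →+ V
  /-- the image of the elements which are annihilated by a power of `P` -/
  W : Submodule P.ResidueField V
  finite : Module.Finite P.ResidueField W
  arithLength_eq : arithLength (MvPolynomial (Fin n) K) ((Fin k → MvPolynomial (Fin n) K) ⧸ M) P
    ‹_› = (Module.finrank P.ResidueField W : ℕ∞)
  q_eq_zero : ∀ w, (∃ t ∉ P, t • w ∈ M) → q w = 0
  q_mem : ∀ w, IsPowTors M P w → q w ∈ W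
  exists_smul_mem : ∀ w, IsPowTors M P w → q w = 0 → ∃ t ∉ P, t • w ∈ M
  exists_smul_eq : ∀ v ∈ W, ∃ c : P.ResidueField, c ≠ 0 ∧ ∃ w, IsPowTors M P w ∧ c • v = q w
  exists_lift : ∀ {ι : Type} [Fintype ι] (a : ι → P.ResidueField), ∃ c : P.ResidueField, c ≠ 0 ∧
    ∃ β : ι → MvPolynomial (Fin n) K, ∀ i,
      taylorShift P S (β i) - C (c * a i) ∈ idealOfVars (Fin n) P.ResidueField ^ r ∧
        ∀ w, q (β i • w) = (c * a i) • q w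
  taylor : ∃ (D : Finset (Fin n → ℕ)) (v : Fin k → (Fin n → ℕ) → V),
    (∀ j α, (∃ i ∈ S, α i ≠ 0) → v j α = 0) ∧
      ∀ m, q m = ∑ j, ∑ α ∈ D, algebraMap _ P.ResidueField (ipdP α (m j)) • v j α

attribute [instance] LocalModel.addCommGroup LocalModel.module

theorem exists_localModel [CharZero K]
    (M : Submodule (MvPolynomial (Fin n) K) (Fin k → MvPolynomial (Fin n) K))
    {P : Ideal (MvPolynomial (Fin n) K)} [P.IsPrime] {S : Finset (Fin n)}
    (hind : ∀ f ∈ P, f ∈ supported K (S : Set (Fin n)) → f = 0)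
    (hmax : ∀ T : Finset (Fin n), S ⊆ T →
      (∀ f ∈ P, f ∈ supported K (T : Set (Fin n)) → f = 0) → T = S) (r₁ : ℕ) :
    ∃ r, r₁ ≤ r ∧ Nonempty (LocalModel M P S r) := by
  have := formallyEtale_residueField hind hmax
  have : IsNoetherianRing (Localization.AtPrime P) :=
    IsLocalization.isNoetherianRing P.primeCompl _ inferInstance
  have : Module.Finite (Localization.AtPrime P)
      (LocalizedModule P.primeCompl ((Fin k → MvPolynomial (Fin n) K) ⧸ M)) :=
    Module.Finite.of_isLocalizedModule P.primeCompl
      (LocalizedModule.mkLinearMap P.primeCompl ((Fin k → MvPolynomial (Fin n) K) ⧸ M))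
  obtain ⟨r₀, hr₀⟩ := exists_pow_smul_top_inf_powTorsion
    (I := IsLocalRing.maximalIdeal (Localization.AtPrime P))
    (N := LocalizedModule P.primeCompl ((Fin k → MvPolynomial (Fin n) K) ⧸ M))
  refine ⟨max r₀ r₁, le_max_right _ _, ?_⟩
  obtain ⟨hinf, -⟩ := hr₀ (max r₀ r₁) (le_max_left _ _)
  generalize max r₀ r₁ = r at hinf
  obtain ⟨σ, hσ⟩ := exists_coefficientField (P := P) (S := S) r
  obtain ⟨V, iV, iA, iκ, p, W, hsmul, hp, hfin, hlen, hpW, hWp, hp0⟩ :=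
    exists_vectorSpace_model (σ : P.ResidueField →+* ArtinQuot P r)
      (exists_sub_coefficientField_mem hσ) hinf
  have hA : ∀ (f : MvPolynomial (Fin n) K) x,
      p (f • x) = algebraMap _ (ArtinQuot P r) f • p x := by
    intro f x
    rw [← algebraMap_smul (Localization.AtPrime P) f, hp]
    rfl
  refine ⟨{
    V := V
    q := p.comp ((LocalizedModule.mkLinearMap P.primeCompl _).comp M.mkQ).toAddMonoidHom
    W := W
    finite := hfin
    arithLength_eq := by rw [arithLength_eq, hlen]
    q_eq_zero := ?_
    q_mem := fun w hw => hpW _ (isPowTors_iff.mp hw)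
    exists_smul_mem := ?_
    exists_smul_eq := ?_
    exists_lift := ?_
    taylor := ?_ }⟩
  · rintro w ⟨t, ht, hw⟩
    have h0 : LocalizedModule.mkLinearMap P.primeCompl _ (M.mkQ w) = 0 := by
      refine mkLinearMap_eq_zero_iff.mpr ⟨t, ht, ?_⟩
      rwa [← map_smul, Submodule.mkQ_apply, Submodule.Quotient.mk_eq_zero]
    exact (congrArg p h0).trans (map_zero p)
  · intro w hw h0
    obtain ⟨t, ht, hw0⟩ := mkLinearMap_eq_zero_iff.mp (hp0 _ (isPowTors_iff.mp hw) h0)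
    refine ⟨t, ht, ?_⟩
    rwa [← map_smul, Submodule.mkQ_apply, Submodule.Quotient.mk_eq_zero] at hw0
  · intro v hv
    obtain ⟨x, hx, rfl⟩ := hWp v hv
    obtain ⟨s, hs, e, he⟩ := exists_smul_eq_mkLinearMap x
    obtain ⟨w, rfl⟩ := M.mkQ_surjective e
    obtain ⟨c, hcS, hcP, β, hβ⟩ := exists_smul_eq_algebraMap hind hmax r
      (Ideal.Quotient.mk _ (IsLocalization.mk' (Localization.AtPrime P) 1 (⟨s, hs⟩ : P.primeCompl)))
    refine ⟨algebraMap _ _ c, fun h => hcP (Ideal.algebraMap_residueField_eq_zero.mp h), β • w,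
      IsPowTors.smul (isPowTors_iff.mpr ?_) β, ?_⟩
    · rw [← he]
      exact Submodule.smul_mem _ _ hx
    · have h1 : x = IsLocalization.mk' (Localization.AtPrime P) 1 (⟨s, hs⟩ : P.primeCompl) •
          LocalizedModule.mkLinearMap P.primeCompl _ (M.mkQ w) := by
        rw [← he, smul_smul, IsLocalization.mk'_spec, map_one, one_smul]
      change _ = p (LocalizedModule.mkLinearMap P.primeCompl _ (M.mkQ (β • w)))
      rw [map_smul, map_smul, hA, ← hβ, mul_smul, ← hp, ← h1, hsmul]
      exact congrArg (· • p x) (coefficientField_of_mem_supported hcS)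
  · intro ι _ a
    obtain ⟨c, hcS, hcP, β, hβ⟩ := exists_coefficientField_mul_eq hind hmax (fun i => σ (a i))
    have h1 : ∀ i, σ (algebraMap _ P.ResidueField c * a i) = algebraMap _ (ArtinQuot P r) (β i) :=
      fun i => (map_mul σ _ _).trans (hβ i)
    refine ⟨algebraMap _ _ c, fun h => hcP (Ideal.algebraMap_residueField_eq_zero.mp h), β,
      fun i => ⟨taylorShift_sub_mem hσ (h1 i), fun w => ?_⟩⟩
    rw [hsmul]
    change p (LocalizedModule.mkLinearMap P.primeCompl _ (M.mkQ (β i • w))) = _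
    rw [map_smul, map_smul, hA, ← h1]
    rfl
  · obtain ⟨h, hS, hh⟩ := algebraMap_artinQuot_eq_sum hσ
    refine ⟨Fintype.piFinset fun _ => Finset.range r, fun j α => h α •
      p (LocalizedModule.mkLinearMap P.primeCompl _ (M.mkQ (Pi.single j 1))), fun j α hα => ?_,
      fun m => ?_⟩
    · beta_reduce
      rw [hS α hα, zero_smul]
    · have hm : m = ∑ j, m j • (Pi.single j 1 : Fin k → MvPolynomial (Fin n) K) := by
        ext1 i
        simp [Finset.sum_apply, Pi.single_apply]
      change p (LocalizedModule.mkLinearMap P.primeCompl _ (M.mkQ m)) = _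
      conv_lhs => rw [hm]
      rw [map_sum, map_sum, map_sum]
      refine Finset.sum_congr rfl fun j _ => ?_
      rw [map_smul, map_smul, hA, hh, Finset.sum_smul]
      refine Finset.sum_congr rfl fun α _ => ?_
      rw [mul_smul, hsmul]
      rfl

end LocalModel

section LocalBounds

variable {K : Type*} [Field K] {n k : ℕ}

theorem IsPowTors.sum {M : Submodule (MvPolynomial (Fin n) K) (Fin k → MvPolynomial (Fin n) K)}
    {P : Ideal (MvPolynomial (Fin n) K)} [P.IsPrime] {ι : Type*} [Fintype ι]
    {w : ι → Fin k → MvPolynomial (Fin n) K} (h : ∀ i, IsPowTors M P (w i)) :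
    IsPowTors M P (∑ i, w i) := by
  rw [isPowTors_iff, map_sum, map_sum]
  exact Submodule.sum_mem _ fun i _ => isPowTors_iff.mp (h i)

theorem exists_noethAct_eq {P : Ideal (MvPolynomial (Fin n) K)} [P.IsPrime] {S : Finset (Fin n)}
    {D : Finset (Fin n → ℕ)} {x : Fin k → (Fin n → ℕ) → P.ResidueField}
    (hx : ∀ j α, (∃ i ∈ S, α i ≠ 0) → x j α = 0) :
    ∃ B : Fin k → MvPolynomial (Fin n) (MvPolynomial (Fin n) K),
      (∀ j, B j ∈ supported (MvPolynomial (Fin n) K) ((S : Set (Fin n))ᶜ)) ∧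
      ∃ d : P.ResidueField, d ≠ 0 ∧ ∀ m : Fin k → MvPolynomial (Fin n) K,
        algebraMap _ P.ResidueField (NoethAct B m) =
          d * ∑ j, ∑ α ∈ D, algebraMap _ P.ResidueField (ipdP α (m j)) * x j α := by
  classical
  obtain ⟨d, hd⟩ := IsLocalization.exist_integer_multiples_of_finset
    (nonZeroDivisors (MvPolynomial (Fin n) K ⧸ P))
    ((Finset.univ ×ˢ D).image fun p : Fin k × (Fin n → ℕ) => x p.1 p.2)
  have hd' : ∀ j, ∀ α ∈ D, ∃ β : MvPolynomial (Fin n) K, algebraMap _ P.ResidueField β =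
      algebraMap (MvPolynomial (Fin n) K ⧸ P) P.ResidueField d.1 * x j α := by
    intro j α hα
    obtain ⟨y, hy⟩ := hd (x j α) (Finset.mem_image.mpr
      ⟨(j, α), Finset.mem_product.mpr ⟨Finset.mem_univ _, hα⟩, rfl⟩)
    obtain ⟨β, rfl⟩ := Ideal.Quotient.mk_surjective y
    refine ⟨β, ?_⟩
    rw [← Algebra.smul_def]
    exact hy
  choose! β hβ using hd'
  set D' := D.filter fun α => ∀ i ∈ S, α i = 0
  set e : (Fin n → ℕ) ↪ (Fin n →₀ ℕ) := Finsupp.equivFunOnFinite.symm.toEmbedding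
  set B : Fin k → MvPolynomial (Fin n) (MvPolynomial (Fin n) K) := fun j =>
    ∑ α ∈ D', monomial (e α) (β j α)
  have hcoeff : ∀ j, ∀ α ∈ D', (B j).coeff (e α) = β j α := by
    intro j α hα
    simp only [B, coeff_sum, coeff_monomial, e.injective.eq_iff]
    rw [Finset.sum_ite_eq' _ _ (fun α => β j α), if_pos hα]
  have hsupp : ∀ j, (B j).support ⊆ D'.map e := by
    intro j α hα
    obtain ⟨γ, hγ, h⟩ := Finset.mem_biUnion.mp (support_sum hα)
    rw [Finset.mem_singleton.mp (support_monomial_subset h)]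
    exact Finset.mem_map_of_mem e hγ
  refine ⟨B, fun j => mem_supported.mpr fun i hi hiS => ?_,
    algebraMap (MvPolynomial (Fin n) K ⧸ P) P.ResidueField d.1,
    IsFractionRing.to_map_ne_zero_of_mem_nonZeroDivisors d.2, fun m => ?_⟩
  · obtain ⟨α, hα, hiα⟩ := (mem_vars_iff_mem_support i).mp hi
    obtain ⟨γ, hγ, rfl⟩ := Finset.mem_map.mp (hsupp j hα)
    exact Finsupp.mem_support_iff.mp hiα ((Finset.mem_filter.mp hγ).2 i hiS)
  · rw [NoethAct, map_sum, Finset.mul_sum]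
    refine Finset.sum_congr rfl fun j _ => ?_
    rw [Finset.sum_subset (hsupp j) (fun α _ hα => by rw [notMem_support_iff.mp hα, zero_mul]),
      Finset.sum_map, map_sum, Finset.mul_sum]
    refine (Finset.sum_congr rfl fun α hα => ?_).trans
      (Finset.sum_subset (Finset.filter_subset _ D) fun α hα hα' => ?_)
    · rw [hcoeff j α hα, map_mul, hβ j α (Finset.mem_filter.mp hα).1, mul_assoc,
        mul_comm (x j α)]
      rfl
    · have : ∃ i ∈ S, α i ≠ 0 := by
        by_contra! h
        exact hα' (Finset.mem_filter.mpr ⟨hα, h⟩)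
      rw [hx j α this, mul_zero, mul_zero]

variable [CharZero K]
  {M : Submodule (MvPolynomial (Fin n) K) (Fin k → MvPolynomial (Fin n) K)}
  {P : Ideal (MvPolynomial (Fin n) K)} [P.IsPrime] {S : Finset (Fin n)}

theorem arithLength_le_card (hind : ∀ f ∈ P, f ∈ supported K (S : Set (Fin n)) → f = 0)
    (hmax : ∀ T : Finset (Fin n), S ⊆ T →
      (∀ f ∈ P, f ∈ supported K (T : Set (Fin n)) → f = 0) → T = S)
    (𝒜 : Finset (Fin k → MvPolynomial (Fin n) (MvPolynomial (Fin n) K)))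
    (h𝒜 : ∀ B ∈ 𝒜, ∀ j, B j ∈ supported (MvPolynomial (Fin n) K) ((S : Set (Fin n))ᶜ))
    (g : MvPolynomial (Fin n) K)
    (hg : ∀ w, IsPowTors M P w → (∀ B ∈ 𝒜, NoethAct B (g • w) ∈ P) → ∃ t ∉ P, t • w ∈ M) :
    arithLength (MvPolynomial (Fin n) K) ((Fin k → MvPolynomial (Fin n) K) ⧸ M) P ‹_› ≤
      (𝒜.card : WithBot ℕ∞) := by
  obtain ⟨r, hr, ⟨E⟩⟩ := exists_localModel M hind hmax
    (𝒜.sup (fun B => Finset.univ.sup fun j => (B j).totalDegree) + 1)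
  have hdeg : ∀ B ∈ 𝒜, ∀ j, (B j).totalDegree < r := fun B hB j =>
    lt_of_lt_of_le (Nat.lt_succ_of_le
      ((Finset.le_sup (f := fun j => (B j).totalDegree) (Finset.mem_univ j)).trans
        (Finset.le_sup (f := fun B => Finset.univ.sup fun j => (B j).totalDegree) hB))) hr
  have := E.finite
  rw [E.arithLength_eq]
  suffices h : Module.finrank P.ResidueField E.W ≤ 𝒜.card by exact_mod_cast h
  by_contra! hlt
  set b := Module.finBasis P.ResidueField E.W
  choose c hc w hw hcw using fun i => E.exists_smul_eq (b i) (b i).2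
  let φ : (Fin (Module.finrank P.ResidueField E.W) → P.ResidueField) →ₗ[P.ResidueField]
      (𝒜 → P.ResidueField) :=
    LinearMap.pi fun B => Fintype.linearCombination P.ResidueField fun i =>
      opFunctional P B.1 fun j => taylorShift P S ((g • w i) j)
  have hker : LinearMap.ker φ ≠ ⊥ := LinearMap.ker_ne_bot_of_finrank_lt (by simpa using hlt)
  obtain ⟨a, ha, ha0⟩ := Submodule.exists_mem_ne_zero_of_ne_bot hker
  obtain ⟨d, hd, β, hβ⟩ := E.exists_lift a
  obtain ⟨t, ht, htM⟩ := hg (∑ i, β i • w i) (IsPowTors.sum fun i => (hw i).smul (β i)) (by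
    intro B hB
    rw [noethAct_mem_iff (h𝒜 B hB)]
    have h1 : opFunctional P B (fun j => taylorShift P S ((g • ∑ i, β i • w i) j)) =
        opFunctional P B (∑ i, (d * a i) • fun j => taylorShift P S ((g • w i) j)) := by
      rw [← sub_eq_zero, ← map_sub]
      refine opFunctional_eq_zero (hdeg B hB) fun j => ?_
      have h2 : ((fun j => taylorShift P S ((g • ∑ i, β i • w i) j)) -
          ∑ i, (d * a i) • fun j => taylorShift P S ((g • w i) j)) j =
          ∑ i, (taylorShift P S (β i) - C (d * a i)) * taylorShift P S ((g • w i) j) := by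
        simp only [Pi.sub_apply, Finset.sum_apply, Pi.smul_apply, smul_eq_mul, map_mul, map_sum,
          smul_eq_C_mul, Finset.mul_sum, ← Finset.sum_sub_distrib]
        refine Finset.sum_congr rfl fun i _ => ?_
        ring
      rw [h2]
      exact Ideal.sum_mem _ fun i _ => Ideal.mul_mem_right _ _ (hβ i).1
    have h3 := congrFun (LinearMap.mem_ker.mp ha) ⟨B, hB⟩
    simp only [φ, LinearMap.pi_apply, Fintype.linearCombination_apply, smul_eq_mul,
      Pi.zero_apply] at h3
    rw [h1, map_sum]
    simp only [map_smul, smul_eq_mul, mul_assoc]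
    rw [← Finset.mul_sum, h3, mul_zero])
  have h4 : ∑ i, (d * a i * c i) • b i = 0 := by
    refine Subtype.ext ?_
    have h5 := E.q_eq_zero _ ⟨t, ht, htM⟩
    simp only [map_sum, (hβ _).2, ← hcw, smul_smul] at h5
    simpa using h5
  refine ha0 (funext fun i => ?_)
  have h6 := Fintype.linearIndependent_iff.mp b.linearIndependent _ h4 i
  exact (mul_eq_zero.mp ((mul_eq_zero.mp h6).resolve_right (hc i))).resolve_left hd

variable (M) in
theorem exists_operators (hind : ∀ f ∈ P, f ∈ supported K (S : Set (Fin n)) → f = 0)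
    (hmax : ∀ T : Finset (Fin n), S ⊆ T →
      (∀ f ∈ P, f ∈ supported K (T : Set (Fin n)) → f = 0) → T = S) :
    ∃ 𝒜 : Finset (Fin k → MvPolynomial (Fin n) (MvPolynomial (Fin n) K)),
      (∀ B ∈ 𝒜, ∀ j, B j ∈ supported (MvPolynomial (Fin n) K) ((S : Set (Fin n))ᶜ)) ∧
      (𝒜.card : WithBot ℕ∞) ≤
        arithLength (MvPolynomial (Fin n) K) ((Fin k → MvPolynomial (Fin n) K) ⧸ M) P ‹_› ∧
      (∀ m ∈ M, ∀ B ∈ 𝒜, NoethAct B m ∈ P) ∧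
      ∀ m, IsPowTors M P m → (∀ B ∈ 𝒜, NoethAct B m ∈ P) → ∃ t ∉ P, t • m ∈ M := by
  classical
  obtain ⟨r, -, ⟨E⟩⟩ := exists_localModel M hind hmax 0
  have := E.finite
  obtain ⟨D, v, hv, hq⟩ := E.taylor
  set b := Module.finBasis P.ResidueField E.W
  choose l hl using fun i => (b.coord i).exists_extend
  have hl' : ∀ i (x : E.W), l i x = b.coord i x := fun i x => LinearMap.congr_fun (hl i) x
  choose B hB d hd hBm using fun i => exists_noethAct_eq (S := S) (D := D)
    (x := fun j α => l i (v j α)) fun j α hα => by rw [hv j α hα, map_zero]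
  have hmem : ∀ i m, NoethAct (B i) m ∈ P ↔ l i (E.q m) = 0 := by
    intro i m
    rw [← Ideal.algebraMap_residueField_eq_zero, hBm, mul_eq_zero_iff_left (hd i), hq]
    simp only [map_sum, map_smul, smul_eq_mul]
  refine ⟨Finset.univ.image B, ?_, ?_, ?_, ?_⟩
  · intro C hC
    obtain ⟨i, -, rfl⟩ := Finset.mem_image.mp hC
    exact hB i
  · rw [E.arithLength_eq]
    have h := (Finset.card_image_le (s := Finset.univ) (f := B)).trans_eq (Finset.card_fin _)
    exact_mod_cast h
  · intro m hm C hC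
    obtain ⟨i, -, rfl⟩ := Finset.mem_image.mp hC
    rw [hmem, E.q_eq_zero m ⟨1, P.ne_top_iff_one.mp (Ideal.IsPrime.ne_top ‹_›), by simpa using hm⟩,
      map_zero]
  · intro m hm h
    refine E.exists_smul_mem m hm ?_
    have h0 : (⟨E.q m, E.q_mem m hm⟩ : E.W) = 0 := by
      refine b.ext_elem fun i => ?_
      rw [map_zero, Finsupp.zero_apply, ← Module.Basis.coord_apply, ← hl']
      exact (hmem i m).mp (h _ (Finset.mem_image_of_mem B (Finset.mem_univ i)))
    exact congrArg Subtype.val h0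

end LocalBounds

theorem exists_mem_pow_of_not_le {R ι : Type*} [CommRing R] [Fintype ι] (P : ι → Ideal R)
    (Q : Ideal R) [Q.IsPrime] (N : ℕ) : ∃ g ∉ Q, ∀ j, ¬P j ≤ Q → g ∈ P j ^ N := by
  have h : ∀ j, ∃ g ∉ Q, ¬P j ≤ Q → g ∈ P j := by
    intro j
    by_cases hj : P j ≤ Q
    · exact ⟨1, Q.ne_top_iff_one.mp (Ideal.IsPrime.ne_top ‹_›), fun h => absurd hj h⟩
    · obtain ⟨g, hg, hgQ⟩ := SetLike.not_le_iff_exists.mp hj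
      exact ⟨g, hgQ, fun _ => hg⟩
  choose g hgQ hg using h
  refine ⟨∏ j, g j ^ N, fun hmem => ?_, fun j hj => ?_⟩
  · obtain ⟨j, -, hj⟩ := (Ideal.IsPrime.prod_mem_iff (p := Q)).mp hmem
    exact hgQ j (Ideal.IsPrime.mem_of_pow_mem ‹_› _ hj)
  · exact Ideal.mem_of_dvd _ (Finset.dvd_prod_of_mem (fun j => g j ^ N) (Finset.mem_univ j))
      (Ideal.pow_mem_pow (hg j hj) N)

section Global

variable {K : Type*} [Field K] {n k : ℕ} {ι : Type*}
  {M : Submodule (MvPolynomial (Fin n) K) (Fin k → MvPolynomial (Fin n) K)}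
  {P : ι → Ideal (MvPolynomial (Fin n) K)}

theorem mem_of_forall_exists_smul_mem
    (hass : associatedPrimes (MvPolynomial (Fin n) K)
      ((Fin k → MvPolynomial (Fin n) K) ⧸ M) ⊆ Set.range P) {m : Fin k → MvPolynomial (Fin n) K}
    (h : ∀ j, ∃ t ∉ P j, t • m ∈ M) : m ∈ M := by
  by_contra hm
  obtain ⟨Q, hQ, hle⟩ := exists_le_isAssociatedPrime_of_isNoetherianRing (MvPolynomial (Fin n) K)
    (M.mkQ m) (by rwa [Submodule.mkQ_apply, Ne, Submodule.Quotient.mk_eq_zero])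
  obtain ⟨j, rfl⟩ := hass hQ
  obtain ⟨t, ht, htm⟩ := h j
  refine ht (hle ?_)
  rwa [Submodule.mem_colon_singleton, Submodule.mem_bot, ← map_smul, Submodule.mkQ_apply,
    Submodule.Quotient.mk_eq_zero]

variable [Finite ι]

theorem isPowTors_of_forall_lt
    (hass : associatedPrimes (MvPolynomial (Fin n) K)
      ((Fin k → MvPolynomial (Fin n) K) ⧸ M) ⊆ Set.range P) {m : Fin k → MvPolynomial (Fin n) K}
    {i : ι} [(P i).IsPrime] (hlt : ∀ j, P j < P i → ∃ t ∉ P j, t • m ∈ M) : IsPowTors M (P i) m := by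
  have := Fintype.ofFinite ι
  set J := Module.annihilator (MvPolynomial (Fin n) K)
    (Submodule.span (MvPolynomial (Fin n) K) {M.mkQ m}) with hJ
  have hmemJ : ∀ f, f ∈ J ↔ f • m ∈ M := by
    intro f
    rw [hJ, ← Submodule.annihilator, Submodule.mem_annihilator_span_singleton, ← map_smul,
      Submodule.mkQ_apply, Submodule.Quotient.mk_eq_zero]
  have hmin : ∀ Q ∈ J.minimalPrimes, ∃ j, P j = Q := fun Q hQ =>
    hass (associatedPrimes.subset_of_injective (Submodule.injective_subtype _)
      (Module.associatedPrimes.minimalPrimes_annihilator_subset_associatedPrimes _ _ hQ))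
  obtain ⟨t, ht, htP⟩ := exists_mem_pow_of_not_le P (P i) 1
  obtain ⟨r, hr⟩ := J.exists_radical_pow_le_of_fg (IsNoetherian.noetherian _)
  refine ⟨r, t ^ r, fun h => ht (Ideal.IsPrime.mem_of_pow_mem ‹_› _ h), fun f hf => ?_⟩
  rw [← hmemJ]
  have hle : Ideal.span {t} * P i ≤ J.radical := by
    rw [Ideal.span_singleton_mul_le_iff]
    intro x hx
    rw [← Ideal.sInf_minimalPrimes, Ideal.mem_sInf]
    intro Q hQ
    obtain ⟨j, rfl⟩ := hmin Q hQ
    by_cases hj : P j ≤ P i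
    · rcases hj.eq_or_lt with h | h
      · exact Ideal.mul_mem_left _ _ (h ▸ hx)
      · obtain ⟨s, hs, hsm⟩ := hlt j h
        exact absurd (hQ.1.2 ((hmemJ s).mpr hsm)) hs
    · exact Ideal.mul_mem_right _ _ (by simpa using htP j hj)
  refine hr (Ideal.pow_right_mono hle r ?_)
  rw [mul_pow]
  exact Ideal.mul_mem_mul (Ideal.pow_mem_pow (Ideal.mem_span_singleton_self t) r) hf

theorem mem_of_forall_isPowTors [∀ i, (P i).IsPrime]
    (hass : associatedPrimes (MvPolynomial (Fin n) K)
      ((Fin k → MvPolynomial (Fin n) K) ⧸ M) ⊆ Set.range P) {m : Fin k → MvPolynomial (Fin n) K}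
    (h : ∀ i, IsPowTors M (P i) m → ∃ t ∉ P i, t • m ∈ M) : m ∈ M := by
  refine mem_of_forall_exists_smul_mem hass fun i => ?_
  have hwf : WellFounded (Order.Preimage P (· < ·)) := Finite.wellFounded_of_trans_of_irrefl _
  induction i using hwf.induction with
  | _ i ih => exact h i (isPowTors_of_forall_lt hass ih)

theorem arithLength_le_card_of_mem_iff [CharZero K] [∀ i, (P i).IsPrime]
    (hinj : Function.Injective P) {S : ι → Finset (Fin n)}
    (hind : ∀ i, ∀ f ∈ P i, f ∈ supported K (S i : Set (Fin n)) → f = 0)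
    (hmax : ∀ i, ∀ T : Finset (Fin n), S i ⊆ T →
      (∀ f ∈ P i, f ∈ supported K (T : Set (Fin n)) → f = 0) → T = S i)
    (𝒜 : ι → Finset (Fin k → MvPolynomial (Fin n) (MvPolynomial (Fin n) K)))
    (h𝒜 : ∀ i, ∀ B ∈ 𝒜 i, ∀ j,
      B j ∈ supported (MvPolynomial (Fin n) K) ((S i : Set (Fin n))ᶜ))
    (hM : ∀ m, m ∈ M ↔ ∀ i, ∀ B ∈ 𝒜 i, NoethAct B m ∈ P i) (i : ι) :
    arithLength (MvPolynomial (Fin n) K) ((Fin k → MvPolynomial (Fin n) K) ⧸ M) (P i)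
      inferInstance ≤ ((𝒜 i).card : WithBot ℕ∞) := by
  have := Fintype.ofFinite ι
  obtain ⟨N, hN⟩ : ∃ N, ∀ i, ∀ B ∈ 𝒜 i, ∀ j, (B j).totalDegree < N :=
    ⟨Finset.univ.sup (fun i => (𝒜 i).sup fun B => Finset.univ.sup fun j => (B j).totalDegree) + 1,
      fun i B hB j => Nat.lt_succ_of_le
      ((Finset.le_sup (f := fun j => (B j).totalDegree) (Finset.mem_univ j)).trans
        ((Finset.le_sup (f := fun B => Finset.univ.sup fun j => (B j).totalDegree) hB).trans
        (Finset.le_sup (f := fun i => (𝒜 i).sup fun B => Finset.univ.sup fun j =>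
          (B j).totalDegree) (Finset.mem_univ i))))⟩
  obtain ⟨g, hg, hgP⟩ := exists_mem_pow_of_not_le P (P i) N
  refine arithLength_le_card (hind i) (hmax i) (𝒜 i) (h𝒜 i) g fun w hw hB => ⟨g, hg, ?_⟩
  rw [hM]
  intro j B hBj
  by_cases hj : P j ≤ P i
  · rcases hj.eq_or_lt with h | h
    · obtain rfl := hinj h
      exact hB B hBj
    · obtain ⟨x, hx, hxj⟩ := SetLike.exists_of_lt h
      obtain ⟨r, t, ht, htw⟩ := hw
      refine noethAct_mem_of_forall_mul (h𝒜 j B hBj) (h := t * x ^ r) (fun hmem => ?_)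
        fun f => (hM _).mp ?_ j B hBj
      · rcases Ideal.IsPrime.mem_or_mem inferInstance hmem with h1 | h1
        · exact ht (hj h1)
        · exact hxj (Ideal.IsPrime.mem_of_pow_mem inferInstance _ h1)
      · rw [smul_smul, mul_right_comm, mul_smul]
        exact M.smul_mem _ (htw _ (Ideal.pow_mem_pow hx r))
  · exact noethAct_mem_of_mem_pow (h𝒜 j B hBj) (hN j B hBj) (hgP j hj) w

end Global

/-- with `S_i` a maximal independent set of variables modulo the associated
prime `P_i`: (a) a differential primary decomposition of `M` can be chosen so that the
elements of `𝒜_i` only involve the differential variables `z_j` with `x_j ∉ S_i`, with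
`|𝒜_i|` the arithmetic length of `M` along `P_i`; (b) for any differential primary
decomposition with `𝒜_i ⊆ K[x][z_j : x_j ∉ S_i]^k`, the cardinality `|𝒜_i|` is at least
the arithmetic length of `M` along `P_i`. -/
theorem stmt13 {n k s : ℕ} (K : Subfield ℂ)
    (M : Submodule (MvPolynomial (Fin n) K) (Fin k → MvPolynomial (Fin n) K))
    (P : Fin s → Ideal (MvPolynomial (Fin n) K))
    (hprime : ∀ i, (P i).IsPrime)
    (hinj : Function.Injective P)
    (hass : associatedPrimes (MvPolynomial (Fin n) K)
        ((Fin k → MvPolynomial (Fin n) K) ⧸ M) = Set.range P)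
    (S : Fin s → Finset (Fin n))
    (hSind : ∀ i, ∀ f ∈ P i,
      f ∈ MvPolynomial.supported K ((S i : Set (Fin n))) → f = 0)
    (hSmax : ∀ i, ∀ T : Finset (Fin n), S i ⊆ T →
      (∀ f ∈ P i, f ∈ MvPolynomial.supported K ((T : Set (Fin n))) → f = 0) → T = S i) :
    (∃ 𝒜 : Fin s → Finset (Fin k → MvPolynomial (Fin n) (MvPolynomial (Fin n) K)),
      (∀ i, ∀ B ∈ 𝒜 i, ∀ j,
        B j ∈ MvPolynomial.supported (MvPolynomial (Fin n) K) ((S i : Set (Fin n))ᶜ)) ∧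
      (∀ m : Fin k → MvPolynomial (Fin n) K,
        m ∈ M ↔ ∀ i, ∀ B ∈ 𝒜 i, NoethAct B m ∈ P i) ∧
      (∀ i, ((𝒜 i).card : WithBot ℕ∞)
        = arithLength (MvPolynomial (Fin n) K)
            ((Fin k → MvPolynomial (Fin n) K) ⧸ M) (P i) (hprime i))) ∧
    (∀ 𝒜 : Fin s → Finset (Fin k → MvPolynomial (Fin n) (MvPolynomial (Fin n) K)),
      (∀ i, ∀ B ∈ 𝒜 i, ∀ j,
        B j ∈ MvPolynomial.supported (MvPolynomial (Fin n) K) ((S i : Set (Fin n))ᶜ)) →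
      (∀ m : Fin k → MvPolynomial (Fin n) K,
        m ∈ M ↔ ∀ i, ∀ B ∈ 𝒜 i, NoethAct B m ∈ P i) →
      ∀ i, arithLength (MvPolynomial (Fin n) K)
          ((Fin k → MvPolynomial (Fin n) K) ⧸ M) (P i) (hprime i)
        ≤ ((𝒜 i).card : WithBot ℕ∞)) := by
  have hass' := hass.subset
  refine ⟨?_, fun 𝒜 h𝒜 hM =>
    arithLength_le_card_of_mem_iff hinj hSind hSmax 𝒜 h𝒜 hM⟩
  choose 𝒜 h𝒜 hcard hmem htors using fun i => exists_operators M (hSind i) (hSmax i)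
  have hM : ∀ m, m ∈ M ↔ ∀ i, ∀ B ∈ 𝒜 i, NoethAct B m ∈ P i := fun m =>
    ⟨fun hm i => hmem i m hm, fun h =>
      mem_of_forall_isPowTors hass' fun i hi => htors i m hi (h i)⟩
  exact ⟨𝒜, h𝒜, hM, fun i => le_antisymm (hcard i)
    (arithLength_le_card_of_mem_iff hinj hSind hSmax 𝒜 h𝒜 hM i)⟩
end
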